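/- arXiv:2203.16431 — 2 statements merged into one kernel-verified Lean document; each statement's English description precedes it below -/
import Mathlib

section
/- Let d < 0 be a fundamental discriminant and f ∈ ℕ. Then h(d f²) = (h(d)·f / (w_d / w_{d f²})) · ∏_{p ∣ f} (1 − (d/p)·(1/p)), where the product is over primes p dividing f and (d/p) is the Kronecker symbol. -/
open scoped BigOperators Classical
open Matrix Filter

noncomputable section

/-! ## Binary quadratic forms, class numbers, and Hurwitz class numbers -/

/-- `(a,b,c)` represents the primitive positive-definite binary quadratic form
`a x² + b x y + c y²` of discriminant `d`. -/
def IsPrimPosDefBQF (d : ℤ) (f : ℤ × ℤ × ℤ) : Prop :=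
  f.2.1 ^ 2 - 4 * f.1 * f.2.2 = d ∧ Int.gcd f.1 (Int.gcd f.2.1 f.2.2) = 1 ∧ 0 < f.1

/-- `SL₂(ℤ)`-equivalence of binary quadratic forms. -/
def BQFEquiv (f g : ℤ × ℤ × ℤ) : Prop :=
  ∃ M : Matrix.SpecialLinearGroup (Fin 2) ℤ,
    g.1 = f.1 * M 0 0 ^ 2 + f.2.1 * M 0 0 * M 1 0 + f.2.2 * M 1 0 ^ 2 ∧
    g.2.1 = 2 * f.1 * M 0 0 * M 0 1 + f.2.1 * (M 0 0 * M 1 1 + M 0 1 * M 1 0) +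
        2 * f.2.2 * M 1 0 * M 1 1 ∧
    g.2.2 = f.1 * M 0 1 ^ 2 + f.2.1 * M 0 1 * M 1 1 + f.2.2 * M 1 1 ^ 2

/-- The class number `h(d)`: the number of `SL₂(ℤ)`-classes of primitive positive-definite
binary quadratic forms of discriminant `d`. -/
def classNum (d : ℤ) : ℕ :=
  Nat.card (Quot fun f g : {f : ℤ × ℤ × ℤ // IsPrimPosDefBQF d f} => BQFEquiv f.1 g.1)

/-- The number of automorphs `w_d`. -/
def wAut (d : ℤ) : ℕ := if d = -3 then 6 else if d = -4 then 4 else 2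

def hurwitzNat (N : ℕ) : ℚ :=
  if 0 < N ∧ (N % 4 = 0 ∨ N % 4 = 3) then
    ∑ f ∈ N.divisors.filter fun f => f ^ 2 ∣ N,
      (classNum (-((N / f ^ 2 : ℕ) : ℤ)) : ℚ) / ((wAut (-((N / f ^ 2 : ℕ) : ℤ)) : ℚ) / 2)
  else 0

/-- Hurwitz class number, with the convention `H(x) = 0` unless `x` is a positive integer
congruent to `0` or `3 (mod 4)`. -/
def hurwitz (x : ℚ) : ℚ := if x.den = 1 ∧ 0 ≤ x.num then hurwitzNat x.num.toNat else 0

/-! ## Kronecker symbol and fundamental discriminants -/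

def kron2 (a : ℤ) : ℤ := if a % 2 = 0 then 0 else if a % 8 = 1 ∨ a % 8 = 7 then 1 else -1

/-- The Kronecker symbol `(a / n)` for `n ∈ ℕ`. -/
def kroneckerSym (a : ℤ) (n : ℕ) : ℤ :=
  kron2 a ^ padicValNat 2 n * jacobiSym a (n / 2 ^ padicValNat 2 n)

/-- Fundamental discriminants. -/
def IsFundamentalDisc (d : ℤ) : Prop :=
  d % 4 = 1 ∧ Squarefree d ∨ d % 4 = 0 ∧ Squarefree (d / 4) ∧ (d / 4 % 4 = 2 ∨ d / 4 % 4 = 3)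

/-! ## Ternary quadratic lattices via Gram matrices -/

abbrev TernMat := Matrix (Fin 3) (Fin 3) ℤ

/-- The quadratic form attached to a Gram matrix. -/
def quadVal {R : Type*} [CommRing R] {k : ℕ} (M : Matrix (Fin k) (Fin k) R) (x : Fin k → R) : R :=
  ∑ i, ∑ j, x i * M i j * x j

/-- `A` is the Gram matrix of a positive-definite integral ternary lattice. -/
def IsLat (A : TernMat) : Prop := A.IsSymm ∧ ∀ x : Fin 3 → ℤ, x ≠ 0 → 0 < quadVal A x

/-- The number of representations of `n` by the lattice with Gram matrix `A`. -/
def rRep (n : ℤ) (A : TernMat) : ℕ := Nat.card {x : Fin 3 → ℤ // quadVal A x = n}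

/-- Isometry of ternary lattices via their Gram matrices. -/
def LatIsom (A B : TernMat) : Prop := ∃ U : TernMat, IsUnit U.det ∧ Uᵀ * A * U = B

/-- The number of automorphs `o(L)`. -/
def numAut (A : TernMat) : ℕ := Nat.card {U : TernMat // IsUnit U.det ∧ Uᵀ * A * U = A}

def padicMat (p : ℕ) [Fact p.Prime] {k : ℕ} (A : Matrix (Fin k) (Fin k) ℤ) :
    Matrix (Fin k) (Fin k) ℤ_[p] := A.map Int.cast

/-- Isometry of `ℤ_p`-lattices given by Gram matrices. -/
def PadicIsomP (p : ℕ) [Fact p.Prime] {k : ℕ} (M N : Matrix (Fin k) (Fin k) ℤ_[p]) : Prop :=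
  ∃ U : Matrix (Fin k) (Fin k) ℤ_[p], IsUnit U.det ∧ Uᵀ * M * U = N

/-- `A ⊗ ℤ_p ≅ B ⊗ ℤ_p`. -/
def PadicLatIsom (p : ℕ) (hp : p.Prime) (A B : TernMat) : Prop :=
  letI : Fact p.Prime := ⟨hp⟩
  PadicIsomP p (padicMat p A) (padicMat p B)

/-- `B` is (the Gram matrix of a lattice) in the genus of `A`. -/
def InGenus (A B : TernMat) : Prop :=
  IsLat B ∧ ∀ (p : ℕ) (hp : p.Prime), PadicLatIsom p hp A B

/-- The mass `w(L)` of the genus of `A`. -/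
def massOf (A : TernMat) : ℝ :=
  ∑ᶠ c : Quot fun B C : {B : TernMat // InGenus A B} => LatIsom B.1 C.1,
    ((numAut (Quot.out c).1 : ℝ))⁻¹

/-- The Siegel–Weil average `r(n, gen(L))`. -/
def rGenus (n : ℤ) (A : TernMat) : ℝ :=
  (massOf A)⁻¹ *
    ∑ᶠ c : Quot fun B C : {B : TernMat // InGenus A B} => LatIsom B.1 C.1,
      (rRep n (Quot.out c).1 : ℝ) / (numAut (Quot.out c).1 : ℝ)

/-! ## Local invariants -/

/-- `L_p` is isotropic. -/
def IsotropicP (p : ℕ) [Fact p.Prime] (A : TernMat) : Prop :=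
  ∃ x : Fin 3 → ℤ_[p], x ≠ 0 ∧ quadVal (padicMat p A) x = 0

/-- The modified Hasse symbol `S_p*(L)`: `1` if `L_p` is isotropic, `-1` if anisotropic. -/
def SpStar (p : ℕ) (A : TernMat) : ℤ :=
  if h : p.Prime then
    letI : Fact p.Prime := ⟨h⟩
    if IsotropicP p A then 1 else -1
  else 1

/-- The lattice is even: all represented numbers are even. -/
def IsEvenLat (A : TernMat) : Prop := ∀ x : Fin 3 → ℤ, 2 ∣ quadVal A x

/-- The lattice is primitive: its scale ideal is `ℤ`. -/
def IsPrimitiveLat (A : TernMat) : Prop :=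
  Finset.univ.gcd (fun ij : Fin 3 × Fin 3 => (A ij.1 ij.2).natAbs) = 1

/-- Stability at a prime `p`. -/
def StableAt (A : TernMat) (p : ℕ) : Prop :=
  padicValInt p A.det ≤ 1 ∧ (p = 2 → (padicValInt 2 A.det = 1 ↔ IsEvenLat A))

/-- A stable (primitive) ternary lattice. -/
def IsStable (A : TernMat) : Prop := IsPrimitiveLat A ∧ ∀ p : ℕ, p.Prime → StableAt A p

def RepresentedAt (p : ℕ) (hp : p.Prime) (n : ℤ) (A : TernMat) : Prop :=
  letI : Fact p.Prime := ⟨hp⟩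
  ∃ x : Fin 3 → ℤ_[p], quadVal (padicMat p A) x = (n : ℤ_[p])

/-- `n` is represented by `L_p` for every prime `p`. -/
def LocallyRepresented (n : ℤ) (A : TernMat) : Prop :=
  ∀ (p : ℕ) (hp : p.Prime), RepresentedAt p hp n A

/-! ## Siegel local densities -/

/-- The Siegel local density `α_p(n, L)` (here `s = 1`, `t = 3`). -/
def localDensity (p : ℕ) (hp : p.Prime) (n : ℤ) (A : TernMat) : ℝ :=
  limUnder atTop fun r : ℕ =>
    (Nat.card {X : Fin 3 → ZMod (p ^ r) //
        (∑ i, ∑ j, X i * (A i j : ZMod (p ^ r)) * X j) = (n : ZMod (p ^ r))} : ℝ) /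
      (p : ℝ) ^ (2 * r)

def localDensityN (p : ℕ) (n : ℤ) (A : TernMat) : ℝ :=
  if h : p.Prime then localDensity p h n A else 0

/-- The value `L(1, χ_a)` of the Dirichlet series attached to the Kronecker symbol `(a/·)`. -/
def LOne (a : ℤ) : ℝ :=
  limUnder atTop fun N : ℕ =>
    ∑ k ∈ Finset.range N, (kroneckerSym a (k + 1) : ℝ) / (k + 1)

/-! ## Watson transformations (Gram matrix form) -/

/-- The underlying set of `Λ_m(L)` in the coordinates of `L`. -/
def watsonSetG (m : ℕ) (A : TernMat) : Set (Fin 3 → ℤ) :=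
  {x | ∀ y : Fin 3 → ℤ, (m : ℤ) ∣ (quadVal A (x + y) - quadVal A y)}

/-- `B` is a Gram matrix for the sublattice `Λ_m(L)` of the lattice `L` with Gram matrix `A`. -/
def IsWatsonGram (m : ℕ) (A B : TernMat) : Prop :=
  ∃ T : TernMat, Set.range T.mulVec = watsonSetG m A ∧ B = Tᵀ * A * T

/-- `B` is a Gram matrix of the Watson transform `λ_m(L)`: the primitive rescaling of `Λ_m(L)`. -/
def IsLambdaGram (m : ℕ) (A B : TernMat) : Prop :=
  IsPrimitiveLat B ∧
    ∃ (B₀ : TernMat) (c : ℚ), 0 < c ∧ IsWatsonGram m A B₀ ∧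
      B.map ((↑) : ℤ → ℚ) = c • B₀.map ((↑) : ℤ → ℚ)

/-- The `3×3` Gram matrix of the orthogonal sum `M ⊥ U`. -/
def blockMat3 {p : ℕ} [Fact p.Prime] (k : ℕ) (hk : k ≤ 3)
    (M : Matrix (Fin k) (Fin k) ℤ_[p]) (U : Matrix (Fin (3 - k)) (Fin (3 - k)) ℤ_[p]) :
    Matrix (Fin 3) (Fin 3) ℤ_[p] :=
  Matrix.reindex (finSumFinEquiv.trans (finCongr (by omega)))
    (finSumFinEquiv.trans (finCongr (by omega))) (Matrix.fromBlocks M 0 0 U)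

end

theorem orbit_count {G X Y : Type*} [Group G] [MulAction G X] [MulAction G Y] (π : Y → X)
    (hπ : ∀ (g : G) y, π (g • y) = g • π y) (w w' n : ℕ) (hw : 0 < w) (hw' : 0 < w') (hn0 : 0 < n)
    (hX : ∀ x : X, Nat.card (MulAction.stabilizer G x) = w)
    (hY : ∀ y : Y, Nat.card (MulAction.stabilizer G y) = w')
    (hn : ∀ x : X, Nat.card {y : Y // π y = x} = n) :
    Nat.card (MulAction.orbitRel.Quotient G Y) * w =
      Nat.card (MulAction.orbitRel.Quotient G X) * (n * w') := by
  let m : MulAction.orbitRel.Quotient G Y → MulAction.orbitRel.Quotient G X :=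
    Quotient.map' π (by
      rintro a b ⟨g, rfl⟩
      exact ⟨g, (hπ g b).symm⟩)
  have key : ∀ x : X, Nat.card {o : MulAction.orbitRel.Quotient G Y // m o = Quotient.mk'' x} * w
      = n * w' := by
    intro x
    let H := MulAction.stabilizer G x
    let F := {y : Y // π y = x}
    let : MulAction H F :=
      { smul := fun h y => ⟨(h : G) • y.1, by
          rw [hπ, y.2]; exact h.2⟩
        one_smul := fun y => Subtype.ext (one_smul G y.1)
        mul_smul := fun g h y => Subtype.ext (mul_smul (g : G) (h : G) y.1) }
    have hsm : ∀ (h : H) (y : F), (h • y).1 = (h : G) • y.1 := fun _ _ => rfl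
    have : Finite F := Nat.finite_of_card_ne_zero (by rw [hn x]; exact hn0.ne')
    have : Finite H := Nat.finite_of_card_ne_zero (by rw [hX x]; exact hw.ne')
    have horb : ∀ y : F, Nat.card (MulAction.orbit H y) * w' = w := by
      intro y
      have e1 : Nat.card (MulAction.stabilizer H y) = w' := by
        rw [← hY y.1]
        refine Nat.card_congr ⟨fun h => ⟨h.1.1, ?_⟩, fun g => ⟨⟨g.1, ?_⟩, ?_⟩, ?_, ?_⟩
        · have := congrArg Subtype.val h.2
          exact this
        · have : g.1 • y.1 = y.1 := g.2
          change g.1 • x = x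
          have h2 := hπ g.1 y.1
          rw [this, y.2] at h2
          exact h2.symm
        · exact Subtype.ext g.2
        · intro h; rfl
        · intro h; rfl
      have e2 := Nat.card_congr (MulAction.orbitEquivQuotientStabilizer H y)
      have e3 := (MulAction.stabilizer H y).card_eq_card_quotient_mul_card_subgroup
      rw [e2, ← e1, ← e3]
      exact hX x
    have hF : Nat.card F * w' = Nat.card (MulAction.orbitRel.Quotient H F) * w := by
      have : Finite (MulAction.orbitRel.Quotient H F) := Quotient.finite _
      let := Fintype.ofFinite (MulAction.orbitRel.Quotient H F)
      rw [Nat.card_congr (MulAction.selfEquivSigmaOrbits H F), Nat.card_sigma, Finset.sum_mul,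
        Finset.sum_congr rfl (fun o _ => horb o.out)]
      simp
    rw [← hn x]
    change _ = Nat.card F * w'
    rw [hF]
    congr 1
    symm
    refine Nat.card_congr (Equiv.ofBijective
      (fun o => Quotient.liftOn' o
        (fun y : F => (⟨Quotient.mk'' y.1, by
          change Quotient.mk'' (π y.1) = _; rw [y.2]⟩ :
          {o : MulAction.orbitRel.Quotient G Y // m o = Quotient.mk'' x})) ?_) ⟨?_, ?_⟩)
    · rintro a b ⟨g, rfl⟩
      apply Subtype.ext
      exact Quotient.sound' ⟨g.1, rfl⟩
    · intro o1 o2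
      induction o1 using Quotient.inductionOn'
      induction o2 using Quotient.inductionOn'
      rename_i a b
      intro h
      have h2 := Quotient.exact' (congrArg Subtype.val h)
      obtain ⟨g, hg⟩ := h2
      have hg : g • b.1 = a.1 := hg
      apply Quotient.sound'
      refine ⟨⟨g, ?_⟩, Subtype.ext hg⟩
      change g • x = x
      have := hπ g b.1
      rw [hg, a.2, b.2] at this
      exact this.symm
    · rintro ⟨o, ho⟩
      induction o using Quotient.inductionOn'
      rename_i a
      obtain ⟨g, hg⟩ := Quotient.exact' ho
      have hg : g • x = π a := hg
      refine ⟨Quotient.mk'' ⟨g⁻¹ • a, ?_⟩, ?_⟩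
      · rw [hπ, ← hg, inv_smul_smul]
      · apply Subtype.ext
        exact Quotient.sound' ⟨g⁻¹, rfl⟩
  have key' : ∀ o, Nat.card {o' : MulAction.orbitRel.Quotient G Y // m o' = o} = n * w' / w := by
    intro o
    induction o using Quotient.inductionOn'
    rw [← key, Nat.mul_div_cancel _ hw]
  by_cases hne : Nonempty X
  · obtain ⟨x⟩ := hne
    have hk := key x
    rw [key'] at hk
    have hpos : n * w' / w ≠ 0 := by
      intro h
      rw [h, zero_mul] at hk
      exact (Nat.mul_pos hn0 hw').ne hk
    have e : ∀ o, Nonempty ({o' : MulAction.orbitRel.Quotient G Y // m o' = o} ≃ Fin (n * w' / w)) := by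
      intro o
      have := Nat.finite_of_card_ne_zero (by rw [key' o]; exact hpos)
      exact ⟨Finite.equivFinOfCardEq (key' o)⟩
    rw [Nat.card_congr ((Equiv.sigmaFiberEquiv m).symm.trans
      ((Equiv.sigmaCongrRight fun o => (e o).some).trans (Equiv.sigmaEquivProd _ _))),
      Nat.card_prod, Nat.card_fin, mul_assoc, hk]
  · rw [not_nonempty_iff] at hne
    have : IsEmpty Y := ⟨fun y => hne.elim (π y)⟩
    simp

/-- The group `SL₂(ℤ)`. -/
abbrev SL2Z := Matrix.SpecialLinearGroup (Fin 2) ℤ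

/-- Substitution of a matrix in a binary quadratic form. -/
def bqfAct (f : ℤ × ℤ × ℤ) (M : SL2Z) : ℤ × ℤ × ℤ :=
  (f.1 * M 0 0 ^ 2 + f.2.1 * M 0 0 * M 1 0 + f.2.2 * M 1 0 ^ 2,
    2 * f.1 * M 0 0 * M 0 1 + f.2.1 * (M 0 0 * M 1 1 + M 0 1 * M 1 0) +
        2 * f.2.2 * M 1 0 * M 1 1,
    f.1 * M 0 1 ^ 2 + f.2.1 * M 0 1 * M 1 1 + f.2.2 * M 1 1 ^ 2)

theorem bqfEquiv_iff (f g : ℤ × ℤ × ℤ) : BQFEquiv f g ↔ ∃ M : SL2Z, g = bqfAct f M := by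
  simp only [BQFEquiv, bqfAct, Prod.ext_iff]

theorem SL2Z_det (M : SL2Z) : M 0 0 * M 1 1 - M 0 1 * M 1 0 = 1 := by
  have := M.det_coe
  rwa [Matrix.det_fin_two] at this

theorem bqfAct_one (f : ℤ × ℤ × ℤ) : bqfAct f 1 = f := by
  simp [bqfAct]

theorem SL2Z_mul_apply (M N : SL2Z) (i j : Fin 2) :
    (M * N) i j = M i 0 * N 0 j + M i 1 * N 1 j := by
  simp [Matrix.mul_apply, Fin.sum_univ_two]

theorem bqfAct_mul (f : ℤ × ℤ × ℤ) (M N : SL2Z) : bqfAct f (M * N) = bqfAct (bqfAct f M) N := by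
  simp only [bqfAct, SL2Z_mul_apply, Prod.mk.injEq]
  refine ⟨?_, ?_, ?_⟩ <;> ring

theorem prim_iff (a b c : ℤ) : Int.gcd a (Int.gcd b c) = 1 ↔
    ∀ n : ℤ, n ∣ a → n ∣ b → n ∣ c → n ∣ 1 := by
  constructor
  · intro h n h1 h2 h3
    have : n ∣ (Int.gcd a (Int.gcd b c) : ℤ) := Int.dvd_coe_gcd h1 (Int.dvd_coe_gcd h2 h3)
    rwa [h] at this
  · intro h
    have h1 : (Int.gcd a (Int.gcd b c) : ℤ) ∣ 1 := by
      apply h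
      · exact Int.gcd_dvd_left ..
      · exact (Int.gcd_dvd_right ..).trans (Int.gcd_dvd_left ..)
      · exact (Int.gcd_dvd_right ..).trans (Int.gcd_dvd_right ..)
    have := Int.natAbs_dvd_natAbs.mpr h1
    simpa using this

theorem prim_bezout {a b c : ℤ} (h : Int.gcd a (Int.gcd b c) = 1) :
    ∃ x y z : ℤ, x * a + y * b + z * c = 1 := by
  have h1 := Int.gcd_eq_gcd_ab a (Int.gcd b c)
  have h2 := Int.gcd_eq_gcd_ab b c
  rw [h] at h1
  set u := Int.gcdA a (Int.gcd b c)
  set v := Int.gcdB a (Int.gcd b c)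
  refine ⟨u, v * Int.gcdA b c, v * Int.gcdB b c, ?_⟩
  rw [h2] at h1
  push_cast at h1
  linear_combination -h1

theorem dvd_bqfAct {n : ℤ} {f : ℤ × ℤ × ℤ} (M : SL2Z) (h1 : n ∣ f.1) (h2 : n ∣ f.2.1)
    (h3 : n ∣ f.2.2) : n ∣ (bqfAct f M).1 ∧ n ∣ (bqfAct f M).2.1 ∧ n ∣ (bqfAct f M).2.2 := by
  obtain ⟨a, b, c⟩ := f
  obtain ⟨a, rfl⟩ := h1
  obtain ⟨b, rfl⟩ := h2
  obtain ⟨c, rfl⟩ := h3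
  have : bqfAct (n * a, n * b, n * c) M =
    (n * (bqfAct (a, b, c) M).1, n * (bqfAct (a, b, c) M).2.1, n * (bqfAct (a, b, c) M).2.2) := by
    simp only [bqfAct, Prod.mk.injEq]
    refine ⟨?_, ?_, ?_⟩ <;> ring
  rw [this]
  exact ⟨⟨_, rfl⟩, ⟨_, rfl⟩, ⟨_, rfl⟩⟩

theorem isPrim_bqfAct {D : ℤ} (hD : D < 0) {f : ℤ × ℤ × ℤ} (hf : IsPrimPosDefBQF D f) (M : SL2Z) :
    IsPrimPosDefBQF D (bqfAct f M) := by
  obtain ⟨h1, h2, h3⟩ := hf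
  have hM := SL2Z_det M
  refine ⟨?_, ?_, ?_⟩
  · rw [← h1]
    simp only [bqfAct]
    linear_combination (f.2.1 ^ 2 - 4 * f.1 * f.2.2) * (M 0 0 * M 1 1 - M 0 1 * M 1 0 + 1) * hM
  · rw [prim_iff] at h2 ⊢
    intro n n1 n2 n3
    have := dvd_bqfAct M⁻¹ n1 n2 n3
    rw [← bqfAct_mul, mul_inv_cancel, bqfAct_one] at this
    exact h2 n this.1 this.2.1 this.2.2
  · have e : 4 * f.1 * (bqfAct f M).1 = (2 * f.1 * M 0 0 + f.2.1 * M 1 0) ^ 2 - D * M 1 0 ^ 2 := by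
      rw [← h1]; simp only [bqfAct]; ring
    have : 0 < 4 * f.1 * (bqfAct f M).1 := by
      rw [e]
      rcases eq_or_ne (M 1 0) 0 with h0 | h0
      · rw [h0] at hM ⊢
        have : M 0 0 ≠ 0 := by
          intro h; rw [h] at hM; simp at hM
        have : 2 * f.1 * M 0 0 ≠ 0 := by positivity
        have := sq_pos_of_ne_zero this
        linarith
      · have := sq_pos_of_ne_zero h0
        nlinarith [sq_nonneg (2 * f.1 * M 0 0 + f.2.1 * M 1 0)]
    exact pos_of_mul_pos_right this (by linarith)

/-- Primitive positive definite forms of discriminant `D`. -/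
abbrev PForm (D : ℤ) := {f : ℤ × ℤ × ℤ // IsPrimPosDefBQF D f}

/-- The action of `SL₂(ℤ)` on forms of discriminant `D`. -/
instance formAction {D : ℤ} [hD : Fact (D < 0)] : MulAction SL2Z (PForm D) where
  smul g f := ⟨bqfAct f.1 g⁻¹, isPrim_bqfAct hD.out f.2 _⟩
  one_smul f := by
    apply Subtype.ext
    change bqfAct f.1 1⁻¹ = f.1
    rw [inv_one, bqfAct_one]
  mul_smul g h f := by
    apply Subtype.ext
    change bqfAct f.1 (g * h)⁻¹ = bqfAct (bqfAct f.1 h⁻¹) g⁻¹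
    rw [_root_.mul_inv_rev, bqfAct_mul]

theorem smul_val {D : ℤ} [Fact (D < 0)] (g : SL2Z) (f : PForm D) :
    (g • f).1 = bqfAct f.1 g⁻¹ := rfl

theorem orbitRel_iff {D : ℤ} [Fact (D < 0)] (f g : PForm D) :
    MulAction.orbitRel SL2Z (PForm D) f g ↔ ∃ M : SL2Z, g.1 = bqfAct f.1 M := by
  constructor
  · rintro ⟨h, rfl⟩
    refine ⟨h, ?_⟩
    change g.1 = bqfAct (bqfAct g.1 h⁻¹) h
    rw [← bqfAct_mul, inv_mul_cancel, bqfAct_one]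
  · rintro ⟨M, hM⟩
    refine ⟨M, Subtype.ext ?_⟩
    change bqfAct g.1 M⁻¹ = f.1
    rw [hM, ← bqfAct_mul, mul_inv_cancel, bqfAct_one]

theorem classNum_eq (D : ℤ) [Fact (D < 0)] :
    classNum D = Nat.card (MulAction.orbitRel.Quotient SL2Z (PForm D)) := by
  refine Nat.card_congr (Quot.congrRight fun f g => ?_)
  rw [bqfEquiv_iff]
  exact (orbitRel_iff f g).symm

/-- Structure of automorphs. -/
theorem automorph_struct {D : ℤ} {f : ℤ × ℤ × ℤ} (hf : IsPrimPosDefBQF D f) {M : SL2Z}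
    (h : bqfAct f M = f) : ∃ u : ℤ, M 1 0 = f.1 * u ∧ M 1 1 - M 0 0 = f.2.1 * u ∧
      M 0 1 = - (f.2.2 * u) ∧ (M 0 0 + M 1 1) ^ 2 - D * u ^ 2 = 4 := by
  obtain ⟨a, b, c⟩ := f
  obtain ⟨h1, h2, h3⟩ := hf
  have hM := SL2Z_det M
  simp only [bqfAct, Prod.mk.injEq] at h h1 h2 h3 ⊢
  obtain ⟨e1, e2, e3⟩ := h
  obtain ⟨x, y, z, hxyz⟩ := prim_bezout h2
  generalize M 0 0 = α at *
  generalize M 0 1 = β at *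
  generalize M 1 0 = γ at *
  generalize M 1 1 = δ at *
  have r1 : a * β + c * γ = 0 := by
    have : 2 * (a * β + c * γ) = 0 := by
      linear_combination δ * e2 - 2 * γ * e3 - (2 * a * β + b * δ) * hM
    omega
  have r2 : a * (α - δ) + b * γ = 0 := by
    have : 2 * (a * (α - δ) + b * γ) = 0 := by
      linear_combination 2 * δ * e1 - γ * e2 - (2 * a * α + b * γ) * hM
    omega
  have r3 : b * β + c * (δ - α) = 0 := by
    have : 2 * (b * β + c * (δ - α)) = 0 := by
      linear_combination - β * e2 + 2 * α * e3 - (b * β + 2 * c * δ) * hM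
    omega
  have s1 : γ = a * (x * γ + y * (δ - α) - z * β) := by
    linear_combination - γ * hxyz + y * r2 + z * r1
  have s2 : δ - α = b * (x * γ + y * (δ - α) - z * β) := by
    linear_combination - (δ - α) * hxyz - x * r2 + z * r3
  have s3 : β = - (c * (x * γ + y * (δ - α) - z * β)) := by
    linear_combination - β * hxyz + x * r1 + y * r3
  generalize x * γ + y * (δ - α) - z * β = u at *
  refine ⟨u, s1, s2, s3, ?_⟩
  subst s1
  subst s3
  obtain rfl : δ = α + b * u := by linarith
  linear_combination 4 * hM + u ^ 2 * h1

/-- The automorph attached to a solution of the Pell type equation. -/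
theorem exists_automorph {D : ℤ} {f : ℤ × ℤ × ℤ} (hf : IsPrimPosDefBQF D f) {t u : ℤ}
    (h : t ^ 2 - D * u ^ 2 = 4) : ∃ M : SL2Z, bqfAct f M = f ∧ M 1 0 = f.1 * u ∧
      M 0 0 + M 1 1 = t := by
  obtain ⟨a, b, c⟩ := f
  obtain ⟨h1, h2, h3⟩ := hf
  simp only at h1 h2 h3 ⊢
  have he : Even ((t - b * u) * (t + b * u)) := by
    refine ⟨2 - 2 * a * c * u ^ 2, ?_⟩
    linear_combination h - u ^ 2 * h1
  have he2 : Even (t - b * u) := by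
    rcases Int.even_mul.mp he with h' | h'
    · exact h'
    · have : t - b * u = (t + b * u) - 2 * (b * u) := by ring
      rw [this]
      exact h'.sub (even_two_mul _)
  obtain ⟨k, hk⟩ := he2
  obtain rfl : t = 2 * k + b * u := by linarith
  have hdet : k * (k + b * u) - (-(c * u)) * (a * u) = 1 := by
    have : 4 * (k * (k + b * u) - (-(c * u)) * (a * u)) = 4 := by
      linear_combination h - u ^ 2 * h1
    omega
  refine ⟨⟨!![k, -(c * u); a * u, k + b * u], ?_⟩, ?_, ?_, ?_⟩
  · rw [Matrix.det_fin_two]; simpa using hdet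
  · simp [bqfAct]
    refine ⟨?_, ?_, ?_⟩
    · linear_combination a * hdet
    · linear_combination b * hdet
    · linear_combination c * hdet
  · simp
  · simp; ring

set_option maxHeartbeats 1000000 in
theorem pell_card {D : ℤ} (hD : D < 0) (hD4 : D % 4 = 0 ∨ D % 4 = 1) :
    Nat.card {tu : ℤ × ℤ // tu.1 ^ 2 - D * tu.2 ^ 2 = 4} = wAut D := by
  have aux : ∀ s : Finset (ℤ × ℤ), (∀ t u : ℤ, t ^ 2 - D * u ^ 2 = 4 ↔ (t, u) ∈ s) →
      Nat.card {tu : ℤ × ℤ // tu.1 ^ 2 - D * tu.2 ^ 2 = 4} = s.card := by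
    intro s hs
    rw [← Nat.card_eq_finsetCard s]
    exact Nat.card_congr (Equiv.subtypeEquivRight fun tu => hs tu.1 tu.2)
  unfold wAut
  split_ifs with h3 h4
  · subst h3
    rw [aux {(2, 0), (-2, 0), (1, 1), (1, -1), (-1, 1), (-1, -1)}]
    · rfl
    · intro t u
      constructor
      · intro h
        have b1 : u ≤ 1 := by nlinarith [sq_nonneg t]
        have b2 : -1 ≤ u := by nlinarith [sq_nonneg t]
        have b3 : t ≤ 2 := by nlinarith [sq_nonneg u]
        have b4 : -2 ≤ t := by nlinarith [sq_nonneg u]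
        interval_cases u <;> interval_cases t <;> first | (norm_num at h; done) | simp
      · intro h
        simp at h
        rcases h with h | h | h | h | h | h <;> simp [h.1, h.2]
  · subst h4
    rw [aux {(2, 0), (-2, 0), (0, 1), (0, -1)}]
    · rfl
    · intro t u
      constructor
      · intro h
        have b1 : u ≤ 1 := by nlinarith [sq_nonneg t]
        have b2 : -1 ≤ u := by nlinarith [sq_nonneg t]
        have b3 : t ≤ 2 := by nlinarith [sq_nonneg u]
        have b4 : -2 ≤ t := by nlinarith [sq_nonneg u]
        interval_cases u <;> interval_cases t <;> first | (norm_num at h; done) | simp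
      · intro h
        simp at h
        rcases h with h | h | h | h <;> simp [h.1, h.2]
  · have hD5 : D < -4 := by omega
    rw [aux {(2, 0), (-2, 0)}]
    · rfl
    · intro t u
      constructor
      · intro h
        have b1 : u < 1 := by
          by_contra hu
          nlinarith [sq_nonneg t, sq_nonneg u]
        have b2 : -1 < u := by
          by_contra hu
          nlinarith [sq_nonneg t, sq_nonneg u]
        obtain rfl : u = 0 := by omega
        have b3 : t ≤ 2 := by nlinarith
        have b4 : -2 ≤ t := by nlinarith
        interval_cases t <;> first | (norm_num at h; done) | simp
      · intro h
        simp at h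
        rcases h with h | h <;> simp [h.1, h.2]

theorem card_stab {D : ℤ} (hD : D < 0) (hD4 : D % 4 = 0 ∨ D % 4 = 1)
    {f : ℤ × ℤ × ℤ} (hf : IsPrimPosDefBQF D f) :
    Nat.card {M : SL2Z // bqfAct f M = f} = wAut D := by
  rw [← pell_card hD hD4]
  symm
  have ex : ∀ tu : {tu : ℤ × ℤ // tu.1 ^ 2 - D * tu.2 ^ 2 = 4}, ∃ M : SL2Z, bqfAct f M = f ∧
    M 1 0 = f.1 * tu.1.2 ∧ M 0 0 + M 1 1 = tu.1.1 := fun tu => exists_automorph hf tu.2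
  choose ψ h1 h2 h3 using ex
  have ha : f.1 ≠ 0 := hf.2.2.ne'
  refine Nat.card_congr (Equiv.ofBijective (fun tu => ⟨ψ tu, h1 tu⟩) ⟨?_, ?_⟩)
  · intro x y hxy
    have hxy : ψ x = ψ y := congrArg Subtype.val hxy
    have e1 := h2 x
    have e2 := h3 x
    rw [hxy] at e1 e2
    rw [h2 y] at e1
    rw [h3 y] at e2
    exact Subtype.ext (Prod.ext e2.symm (mul_left_cancel₀ ha e1).symm)
  · rintro ⟨M, hM⟩
    obtain ⟨u, u1, u2, u3, u4⟩ := automorph_struct hf hM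
    refine ⟨⟨(M 0 0 + M 1 1, u), u4⟩, Subtype.ext ?_⟩
    set tu : {tu : ℤ × ℤ // tu.1 ^ 2 - D * tu.2 ^ 2 = 4} := ⟨(M 0 0 + M 1 1, u), u4⟩ with htu
    obtain ⟨v, v1, v2, v3, v4⟩ := automorph_struct hf (h1 tu)
    have e1 := h2 tu
    have e2 := h3 tu
    have huv : u = v := mul_left_cancel₀ ha (by rw [← v1, e1])
    subst huv
    have e2 : ψ tu 0 0 + ψ tu 1 1 = M 0 0 + M 1 1 := e2
    apply Matrix.SpecialLinearGroup.ext
    intro i j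
    change ψ tu i j = M i j
    fin_cases i <;> fin_cases j
    · change ψ tu 0 0 = M 0 0
      omega
    · change ψ tu 0 1 = M 0 1
      rw [v3, u3]
    · change ψ tu 1 0 = M 1 0
      rw [v1, u1]
    · change ψ tu 1 1 = M 1 1
      omega

open CongruenceSubgroup in
theorem mem_Gamma0_iff (p : ℕ) (M : SL2Z) : M ∈ Gamma0 p ↔ (p : ℤ) ∣ M 1 0 := by
  rw [Gamma0_mem, ZMod.intCast_zmod_eq_zero_iff_dvd]

theorem dvd_act_Gamma0 {p : ℕ} (f : ℤ × ℤ × ℤ) {k : SL2Z}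
    (hk : k ∈ CongruenceSubgroup.Gamma0 p) (h : (p : ℤ) ∣ f.1) :
    (p : ℤ) ∣ (bqfAct f k).1 := by
  rw [mem_Gamma0_iff] at hk
  obtain ⟨a, ha⟩ := h
  obtain ⟨c, hc⟩ := hk
  simp only [bqfAct]
  rw [hc, ha]
  exact ⟨a * k 0 0 ^ 2 + f.2.1 * k 0 0 * c + f.2.2 * (p * c ^ 2), by ring⟩

/-- The line `c` is not a zero of the form `f` modulo `p`. -/
def NR (p : ℕ) (f : ℤ × ℤ × ℤ) (c : SL2Z ⧸ CongruenceSubgroup.Gamma0 p) : Prop :=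
  ¬ (p : ℤ) ∣ (bqfAct f c.out).1

theorem NR_mk (p : ℕ) (f : ℤ × ℤ × ℤ) (g : SL2Z) :
    NR p f (g : SL2Z ⧸ CongruenceSubgroup.Gamma0 p) ↔ ¬ (p : ℤ) ∣ (bqfAct f g).1 := by
  unfold NR
  set c : SL2Z ⧸ CongruenceSubgroup.Gamma0 p := (g : SL2Z ⧸ CongruenceSubgroup.Gamma0 p)
  have h : (c.out : SL2Z ⧸ CongruenceSubgroup.Gamma0 p) = g := Quotient.out_eq' c
  rw [QuotientGroup.eq] at h
  rw [not_iff_not]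
  constructor
  · intro h1
    have := dvd_act_Gamma0 _ h h1
    rwa [← bqfAct_mul, mul_inv_cancel_left] at this
  · intro h1
    have := dvd_act_Gamma0 _ (inv_mem h) h1
    rwa [← bqfAct_mul, _root_.mul_inv_rev, inv_inv, mul_inv_cancel_left] at this

/-- Pairs of a form and a line which is not a zero of the form modulo `p`. -/
abbrev YY (D : ℤ) (p : ℕ) :=
  {y : PForm D × (SL2Z ⧸ CongruenceSubgroup.Gamma0 p) // NR p y.1.1 y.2}

theorem NR_smul {D : ℤ} [Fact (D < 0)] (p : ℕ) (f : PForm D) (h : SL2Z)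
    (c : SL2Z ⧸ CongruenceSubgroup.Gamma0 p) (hc : NR p f.1 c) : NR p (h • f).1 (h • c) := by
  induction c using QuotientGroup.induction_on
  rename_i g
  change NR p (h • f).1 ((h * g : SL2Z) : SL2Z ⧸ CongruenceSubgroup.Gamma0 p)
  rw [NR_mk] at hc ⊢
  rwa [smul_val, ← bqfAct_mul, inv_mul_cancel_left]

instance actionYY {D : ℤ} [Fact (D < 0)] {p : ℕ} : MulAction SL2Z (YY D p) where
  smul g y := ⟨(g • y.1.1, g • y.1.2), NR_smul p _ _ _ y.2⟩
  one_smul _ := Subtype.ext (Prod.ext (one_smul _ _) (one_smul _ _))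
  mul_smul _ _ _ := Subtype.ext (Prod.ext (mul_smul _ _ _) (mul_smul _ _ _))

theorem bqfAct_neg_one (f : ℤ × ℤ × ℤ) : bqfAct f (-1) = f := by
  simp [bqfAct]

theorem card_stab_X {D : ℤ} [hD : Fact (D < 0)] (hD4 : D % 4 = 0 ∨ D % 4 = 1) (f : PForm D) :
    Nat.card (MulAction.stabilizer SL2Z f) = wAut D := by
  rw [← card_stab hD.out hD4 f.2]
  refine Nat.card_congr ((Equiv.inv SL2Z).subtypeEquiv fun g => ?_)
  rw [MulAction.mem_stabilizer_iff, Subtype.ext_iff, smul_val]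
  rfl

theorem card_stab_Y {D : ℤ} [hD : Fact (D < 0)] (hD4 : D % 4 = 0 ∨ D % 4 = 1) {p : ℕ}
    (hp : p.Prime) (y : YY D p) : Nat.card (MulAction.stabilizer SL2Z y) = 2 := by
  have h1 : ((MulAction.stabilizer SL2Z y : Subgroup SL2Z) : Set SL2Z) = {1, -1} := by
    obtain ⟨⟨f, c⟩, hc⟩ := y
    induction c using QuotientGroup.induction_on
    rename_i g
    have hc' := hc
    rw [NR_mk] at hc'
    ext M
    simp only [SetLike.mem_coe, MulAction.mem_stabilizer_iff, Set.mem_insert_iff,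
      Set.mem_singleton_iff]
    constructor
    · intro h
      have h' := congrArg Subtype.val h
      have e1 : M • f = f := congrArg Prod.fst h'
      have e2 : ((M * g : SL2Z) : SL2Z ⧸ CongruenceSubgroup.Gamma0 p) = g := congrArg Prod.snd h'
      have e1 : bqfAct f.1 M⁻¹ = f.1 := congrArg Subtype.val e1
      rw [QuotientGroup.eq, mem_Gamma0_iff] at e2
      have e3 : bqfAct (bqfAct f.1 g) ((M * g)⁻¹ * g) = bqfAct f.1 g := by
        rw [← bqfAct_mul, _root_.mul_inv_rev, mul_assoc, mul_inv_cancel_left, bqfAct_mul, e1]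
      obtain ⟨u, u1, u2, u3, u4⟩ := automorph_struct (isPrim_bqfAct hD.out f.2 g) e3
      rw [u1] at e2
      have hpu : (p : ℤ) ∣ u :=
        ((Nat.prime_iff_prime_int.mp hp).dvd_or_dvd e2).resolve_left hc'
      have hu : u = 0 := by
        obtain ⟨v, rfl⟩ := hpu
        by_contra hne
        have hv : v ≠ 0 := fun h => hne (by rw [h, mul_zero])
        have hv1 : 1 ≤ v ^ 2 := by have := sq_pos_of_ne_zero hv; omega
        have hp2 : (2 : ℤ) ≤ p := by exact_mod_cast hp.two_le
        have hp4 : (4 : ℤ) ≤ (p : ℤ) ^ 2 := by nlinarith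
        have hD3 : D ≤ -3 := by have := hD.out; omega
        have : (4 : ℤ) ≤ (p * v) ^ 2 := by rw [mul_pow]; nlinarith
        nlinarith [sq_nonneg (((M * g)⁻¹ * g) 0 0 + ((M * g)⁻¹ * g) 1 1)]
      subst hu
      have hk : (M * g)⁻¹ * g = 1 ∨ (M * g)⁻¹ * g = -1 := by
        generalize (M * g)⁻¹ * g = k at *
        have hdet := SL2Z_det k
        rw [mul_zero] at u1 u2 u3
        have e11 : k 1 1 = k 0 0 := by linarith
        rw [neg_zero] at u3
        rw [u1, u3, e11] at hdet
        have : (k 0 0 - 1) * (k 0 0 + 1) = 0 := by linarith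
        rcases mul_eq_zero.mp this with h | h
        · left
          have e00 : k 0 0 = 1 := by linarith
          rw [e00] at e11
          apply Matrix.SpecialLinearGroup.ext
          intro i j
          fin_cases i <;> fin_cases j <;> simp [e00, u1, u3, e11]
        · right
          have e00 : k 0 0 = -1 := by linarith
          rw [e00] at e11
          apply Matrix.SpecialLinearGroup.ext
          intro i j
          fin_cases i <;> fin_cases j <;> simp [e00, u1, u3, e11]
      rcases hk with h | h
      · left
        rw [_root_.mul_inv_rev, mul_assoc, inv_mul_eq_one] at h
        have := mul_eq_right.mp h.symm
        exact inv_eq_one.mp this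
      · right
        rw [inv_mul_eq_iff_eq_mul, mul_neg, mul_one] at h
        have h2 : M * g = -1 * g := by
          rw [neg_mul, one_mul]; exact (neg_eq_iff_eq_neg.mpr h).symm
        exact mul_right_cancel h2
    · rintro (rfl | rfl)
      · exact one_smul _ _
      · apply Subtype.ext
        apply Prod.ext
        · apply Subtype.ext
          change bqfAct f.1 (-1)⁻¹ = f.1
          have : (-1 : SL2Z)⁻¹ = -1 := by
            rw [inv_eq_iff_mul_eq_one]; simp
          rw [this, bqfAct_neg_one]
        · change ((-1 * g : SL2Z) : SL2Z ⧸ CongruenceSubgroup.Gamma0 p) = g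
          rw [QuotientGroup.eq, mem_Gamma0_iff]
          have : (-1 * g)⁻¹ * g = -1 := by
            rw [inv_mul_eq_iff_eq_mul]; simp
          rw [this]
          simp
  have h2 : Nat.card (MulAction.stabilizer SL2Z y) =
      ((MulAction.stabilizer SL2Z y : Subgroup SL2Z) : Set SL2Z).ncard := rfl
  rw [h2, h1, Set.ncard_pair]
  intro h
  have := congrArg (fun M : SL2Z => M 0 0) h
  simp at this

/-- Representatives of the lines modulo `p`. -/
def lineRep (p : ℕ) : Option (ZMod p) → SL2Z
  | none => 1
  | some i => ⟨!![(i.val : ℤ), -1; 1, 0], by simp [Matrix.det_fin_two]⟩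

theorem inv_mul_one_zero (g h : SL2Z) : (g⁻¹ * h) 1 0 = g 0 0 * h 1 0 - g 1 0 * h 0 0 := by
  rw [SL2Z_mul_apply, Matrix.SpecialLinearGroup.SL2_inv_expl]
  simp
  ring

theorem lineRep_bij (p : ℕ) (hp : p.Prime) : Function.Bijective
    (fun i => (lineRep p i : SL2Z ⧸ CongruenceSubgroup.Gamma0 p)) := by
  have : Fact p.Prime := ⟨hp⟩
  constructor
  · intro i j h
    simp only at h
    rw [QuotientGroup.eq, mem_Gamma0_iff, inv_mul_one_zero,
      ← ZMod.intCast_zmod_eq_zero_iff_dvd] at h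
    cases i <;> cases j <;> simp [lineRep, sub_eq_zero] at h ⊢
    exact h
  · intro c
    induction c using QuotientGroup.induction_on
    rename_i g
    by_cases hg : (g 1 0 : ZMod p) = 0
    · refine ⟨none, ?_⟩
      simp only
      rw [QuotientGroup.eq, mem_Gamma0_iff, inv_mul_one_zero,
        ← ZMod.intCast_zmod_eq_zero_iff_dvd]
      simp [lineRep, hg]
    · refine ⟨some ((g 0 0 : ZMod p) / (g 1 0 : ZMod p)), ?_⟩
      simp only
      rw [QuotientGroup.eq, mem_Gamma0_iff, inv_mul_one_zero,
        ← ZMod.intCast_zmod_eq_zero_iff_dvd]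
      simp [lineRep]
      field_simp
      simp

/-- The non-vanishing condition in coordinates. -/
def lineCond (p : ℕ) (f : ℤ × ℤ × ℤ) : Option (ZMod p) → Prop
  | none => (f.1 : ZMod p) ≠ 0
  | some i => (f.1 : ZMod p) * i ^ 2 + f.2.1 * i + f.2.2 ≠ 0

theorem card_fiber {D : ℤ} (p : ℕ) (hp : p.Prime) (x : PForm D) :
    Nat.card {y : YY D p // y.1.1 = x} = Nat.card {i : Option (ZMod p) // lineCond p x.1 i} := by
  have : Fact p.Prime := ⟨hp⟩
  have e1 : Nat.card {i : Option (ZMod p) // lineCond p x.1 i} =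
      Nat.card {c : SL2Z ⧸ CongruenceSubgroup.Gamma0 p // NR p x.1 c} := by
    refine Nat.card_congr ((Equiv.ofBijective _ (lineRep_bij p hp)).subtypeEquiv fun i => ?_)
    simp only [Equiv.ofBijective_apply]
    rw [NR_mk, ← ZMod.intCast_zmod_eq_zero_iff_dvd]
    cases i <;> simp [lineRep, lineCond, bqfAct]
  rw [e1]
  refine Nat.card_congr ⟨fun y => ⟨y.1.1.2, 
    (congrArg (fun z : PForm D => NR p z.1 y.1.1.2) y.2).mp y.1.2⟩,
    fun c => ⟨⟨(x, c.1), c.2⟩, rfl⟩, ?_, fun c => rfl⟩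
  rintro ⟨⟨⟨f, c⟩, h⟩, rfl⟩
  rfl

/-- The form `R(x, p y)`. -/
def stretch (p : ℕ) (R : ℤ × ℤ × ℤ) : ℤ × ℤ × ℤ := (R.1, p * R.2.1, p ^ 2 * R.2.2)

theorem isPrim_stretch {D : ℤ} {p : ℕ} (hp : p.Prime) {R : ℤ × ℤ × ℤ} (hR : IsPrimPosDefBQF D R)
    (ha : ¬ (p : ℤ) ∣ R.1) : IsPrimPosDefBQF (D * (p : ℤ) ^ 2) (stretch p R) := by
  obtain ⟨h1, h2, h3⟩ := hR
  refine ⟨?_, ?_, h3⟩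
  · rw [← h1]; simp only [stretch]; ring
  · rw [prim_iff] at h2 ⊢
    intro n n1 n2 n3
    simp only [stretch] at n1 n2 n3
    have hcop : IsCoprime n (p : ℤ) := by
      have h := ((Nat.prime_iff_prime_int.mp hp).coprime_iff_not_dvd).mpr ha
      exact (h.of_isCoprime_of_dvd_right n1).symm
    exact h2 n n1 (hcop.dvd_of_dvd_mul_left n2) (hcop.pow_right.dvd_of_dvd_mul_left n3)

theorem stretch_equiv_iff {p : ℕ} (hp : p.Prime) {R R' : ℤ × ℤ × ℤ} (ha : ¬ (p : ℤ) ∣ R.1) :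
    (∃ M : SL2Z, stretch p R' = bqfAct (stretch p R) M) ↔
      ∃ k ∈ CongruenceSubgroup.Gamma0 p, R' = bqfAct R k := by
  have hp' := Nat.prime_iff_prime_int.mp hp
  have hp0 : (p : ℤ) ≠ 0 := hp'.ne_zero
  obtain ⟨a, b, c⟩ := R
  obtain ⟨a', b', c'⟩ := R'
  constructor
  · rintro ⟨M, hM⟩
    have hdet := SL2Z_det M
    simp only [stretch, bqfAct, Prod.mk.injEq] at hM ha
    obtain ⟨e1, e2, e3⟩ := hM
    have hd : (p : ℤ) ∣ M 0 1 := by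
      have : (p : ℤ) ∣ a * M 0 1 ^ 2 := by
        refine ⟨p * c' - b * M 0 1 * M 1 1 - p * c * M 1 1 ^ 2, ?_⟩
        linear_combination -e3
      exact hp'.dvd_of_dvd_pow ((hp'.dvd_or_dvd this).resolve_left ha)
    obtain ⟨m, hm⟩ := hd
    rw [hm] at hdet e2 e3
    refine ⟨⟨!![M 0 0, m; p * M 1 0, M 1 1], ?_⟩, ?_, ?_⟩
    · rw [Matrix.det_fin_two]; simp; linarith
    · exact (mem_Gamma0_iff p _).mpr (by simp)
    · simp [bqfAct]
      refine ⟨?_, ?_, ?_⟩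
      · linear_combination e1
      · apply mul_left_cancel₀ hp0
        linear_combination e2
      · apply mul_left_cancel₀ (pow_ne_zero 2 hp0)
        linear_combination e3
  · rintro ⟨k, hk, hk2⟩
    have hdet := SL2Z_det k
    rw [mem_Gamma0_iff] at hk
    obtain ⟨m, hm⟩ := hk
    simp only [bqfAct, Prod.mk.injEq] at hk2
    obtain ⟨e1, e2, e3⟩ := hk2
    rw [hm] at hdet e1 e2
    refine ⟨⟨!![k 0 0, p * k 0 1; m, k 1 1], ?_⟩, ?_⟩
    · rw [Matrix.det_fin_two]; simp; linarith
    · simp [bqfAct, stretch]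
      refine ⟨?_, ?_, ?_⟩
      · linear_combination e1
      · linear_combination p * e2
      · linear_combination p ^ 2 * e3

theorem exists_stretch_aux {D : ℤ} {p : ℕ}
    (hp : p.Prime) {f : ℤ × ℤ × ℤ} (hf : IsPrimPosDefBQF (D * (p : ℤ) ^ 2) f) :
    ∃ M : SL2Z, (p : ℤ) ∣ (bqfAct f M).2.1 ∧ (p : ℤ) ∣ (bqfAct f M).2.2 := by
  have hp' := Nat.prime_iff_prime_int.mp hp
  obtain ⟨a, b, c⟩ := f
  obtain ⟨h1, h2, h3⟩ := hf
  simp only at h1 h2 h3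
  have hb2 : p = 2 → (p : ℤ) ∣ b := by
    rintro rfl
    apply Int.prime_two.dvd_of_dvd_pow (n := 2)
    push_cast at h1
    exact ⟨2 * D + 2 * a * c, by linarith⟩
  by_cases ha : (p : ℤ) ∣ a
  · have hb : (p : ℤ) ∣ b := by
      apply hp'.dvd_of_dvd_pow (n := 2)
      obtain ⟨m, rfl⟩ := ha
      exact ⟨D * p + 4 * m * c, by linear_combination h1⟩
    refine ⟨⟨!![0, -1; 1, 0], by simp [Matrix.det_fin_two]⟩, ?_, ?_⟩
    · simpa [bqfAct] using hb
    · simpa [bqfAct] using ha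
  · suffices h : ∃ x : ℤ, (p : ℤ) ∣ 2 * a * x + b ∧ (p : ℤ) ∣ a * x ^ 2 + b * x + c by
      obtain ⟨x, hx1, hx2⟩ := h
      refine ⟨⟨!![1, x; 0, 1], by simp [Matrix.det_fin_two]⟩, ?_, ?_⟩
      · simpa [bqfAct] using hx1
      · simpa [bqfAct] using hx2
    by_cases hp2 : p = 2
    · have hb := hb2 hp2
      subst hp2
      refine ⟨c, (dvd_mul_of_dvd_left (dvd_mul_right _ _) _).add hb, ?_⟩
      push_cast at ha hb ⊢
      obtain ⟨m, rfl⟩ := hb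
      obtain ⟨k, rfl⟩ : Odd a := by
        rw [← Int.not_even_iff_odd, even_iff_two_dvd]; exact ha
      obtain ⟨l, hl⟩ := Int.even_mul_succ_self c
      exact ⟨k * c ^ 2 + m * c + l, by linear_combination hl⟩
    · have h2a : ¬ (p : ℤ) ∣ 2 * a := by
        intro h
        rcases hp'.dvd_or_dvd h with h | h
        · have : p ∣ 2 := by exact_mod_cast h
          exact hp2 ((Nat.prime_dvd_prime_iff_eq hp Nat.prime_two).mp this)
        · exact ha h
      obtain ⟨r, s, hrs⟩ := (hp'.coprime_iff_not_dvd).mpr h2a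
      have hx : (p : ℤ) ∣ 2 * a * (-(s * b)) + b := ⟨r * b, by linear_combination -b * hrs⟩
      refine ⟨-(s * b), hx, ?_⟩
      generalize -(s * b) = x at hx
      have h4a : (p : ℤ) ∣ (2 * a) * (2 * (a * x ^ 2 + b * x + c)) := by
        obtain ⟨m, hm⟩ := hx
        refine ⟨m * (2 * a * x + b) - D * p, ?_⟩
        linear_combination (2 * a * x + b) * hm - h1
      have h4 := (hp'.dvd_or_dvd h4a).resolve_left h2a
      refine (hp'.dvd_or_dvd h4).resolve_left fun h => ?_
      exact h2a (dvd_mul_of_dvd_left h a)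

theorem exists_stretch {D : ℤ} (hD : D < 0) (hD4 : D % 4 = 0 ∨ D % 4 = 1) {p : ℕ}
    (hp : p.Prime) {f : ℤ × ℤ × ℤ} (hf : IsPrimPosDefBQF (D * (p : ℤ) ^ 2) f) :
    ∃ (M : SL2Z) (R : ℤ × ℤ × ℤ), IsPrimPosDefBQF D R ∧ ¬ (p : ℤ) ∣ R.1 ∧
      bqfAct f M = stretch p R := by
  have hp' := Nat.prime_iff_prime_int.mp hp
  have hp0 : (p : ℤ) ≠ 0 := hp'.ne_zero
  obtain ⟨M, hb, hc⟩ := exists_stretch_aux hp hf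
  have hDp : D * (p : ℤ) ^ 2 < 0 := by
    have : 0 < (p : ℤ) ^ 2 := by positivity
    nlinarith
  have hf' := isPrim_bqfAct hDp hf M
  refine ⟨M, ?_⟩
  generalize bqfAct f M = g at *
  obtain ⟨a, b, c⟩ := g
  obtain ⟨h1, h2, h3⟩ := hf'
  simp only at h1 h2 h3 hb hc
  rw [prim_iff] at h2
  have ha : ¬ (p : ℤ) ∣ a := fun ha => hp'.not_dvd_one (h2 p ha hb hc)
  obtain ⟨b, rfl⟩ := hb
  have hc2 : (p : ℤ) ^ 2 ∣ c := by
    obtain ⟨c, rfl⟩ := hc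
    have key : (p : ℤ) * (b ^ 2 - D) = 4 * a * c := by
      apply mul_left_cancel₀ hp0
      linear_combination h1
    rw [sq]
    apply mul_dvd_mul_left
    by_cases hp2 : p = 2
    · subst hp2
      push_cast at *
      have hac : a * c = 2 * ((b ^ 2 - D) / 4) := by
        have hsq : b ^ 2 % 4 = 0 ∨ b ^ 2 % 4 = 1 := by
          rcases Int.even_or_odd b with ⟨k, rfl⟩ | ⟨k, rfl⟩
          · left; ring_nf; omega
          · right; ring_nf; omega
        have hk : b ^ 2 - D = 2 * (a * c) := by linarith
        omega
      exact (Int.prime_two.dvd_or_dvd ⟨_, hac⟩).resolve_left ha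
    · have h4 : (p : ℤ) ∣ 4 * a * c := ⟨_, key.symm⟩
      have hn4 : ¬ (p : ℤ) ∣ 4 := by
        intro h
        have h : p ∣ 2 ^ 2 := by exact_mod_cast h
        exact hp2 ((Nat.prime_dvd_prime_iff_eq hp Nat.prime_two).mp (hp.dvd_of_dvd_pow h))
      rcases hp'.dvd_or_dvd h4 with h | h
      · rcases hp'.dvd_or_dvd h with h | h
        · exact absurd h hn4
        · exact absurd h ha
      · exact h
  obtain ⟨c, rfl⟩ := hc2
  refine ⟨(a, b, c), ⟨?_, ?_, h3⟩, ha, rfl⟩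
  · apply mul_left_cancel₀ (pow_ne_zero 2 hp0)
    linear_combination h1
  · rw [prim_iff]
    intro n n1 n2 n3
    exact h2 n n1 (n2.mul_left _) (n3.mul_left _)

theorem card_orbits_YY {D : ℤ} [hD : Fact (D < 0)] (hD4 : D % 4 = 0 ∨ D % 4 = 1) {p : ℕ}
    (hp : p.Prime) [Fact (D * (p : ℤ) ^ 2 < 0)] :
    Nat.card (MulAction.orbitRel.Quotient SL2Z (YY D p)) =
      Nat.card (MulAction.orbitRel.Quotient SL2Z (PForm (D * (p : ℤ) ^ 2))) := by
  let F : YY D p → PForm (D * (p : ℤ) ^ 2) := fun y =>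
    ⟨stretch p (bqfAct y.1.1.1 y.1.2.out), isPrim_stretch hp (isPrim_bqfAct hD.out y.1.1.2 _) y.2⟩
  have hF : ∀ y y' : YY D p, MulAction.orbitRel SL2Z (YY D p) y y' ↔
      MulAction.orbitRel SL2Z (PForm (D * (p : ℤ) ^ 2)) (F y) (F y') := by
    intro y y'
    rw [orbitRel_iff]
    refine Iff.trans ?_ (stretch_equiv_iff hp y.2).symm
    obtain ⟨⟨f, c⟩, hc⟩ := y
    obtain ⟨⟨f', c'⟩, hc'⟩ := y'
    have o1 : (c.out : SL2Z ⧸ CongruenceSubgroup.Gamma0 p) = c := Quotient.out_eq' c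
    have o2 : (c'.out : SL2Z ⧸ CongruenceSubgroup.Gamma0 p) = c' := Quotient.out_eq' c'
    simp only
    generalize c.out = g at *
    generalize c'.out = g' at *
    subst o1
    subst o2
    constructor
    · rintro ⟨h, hh⟩
      have h' := congrArg Subtype.val hh
      have e1 : h • f' = f := congrArg Prod.fst h'
      have e2 : ((h * g' : SL2Z) : SL2Z ⧸ CongruenceSubgroup.Gamma0 p) = g := congrArg Prod.snd h'
      have e1 : bqfAct f'.1 h⁻¹ = f.1 := congrArg Subtype.val e1
      rw [QuotientGroup.eq] at e2
      refine ⟨_, inv_mem e2, ?_⟩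
      rw [← e1, ← bqfAct_mul, ← bqfAct_mul]
      congr 1
      group
    · rintro ⟨k, hk, e⟩
      refine ⟨g * k * g'⁻¹, Subtype.ext (Prod.ext (Subtype.ext ?_) ?_)⟩
      · change bqfAct f'.1 (g * k * g'⁻¹)⁻¹ = f.1
        have : (g * k * g'⁻¹)⁻¹ = g' * (k⁻¹ * g⁻¹) := by group
        rw [this, bqfAct_mul, e, ← bqfAct_mul, ← bqfAct_mul]
        have : g * (k * (k⁻¹ * g⁻¹)) = 1 := by group
        rw [← mul_assoc] at this
        simp [bqfAct_one]
      · change ((g * k * g'⁻¹ * g' : SL2Z) : SL2Z ⧸ CongruenceSubgroup.Gamma0 p) = g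
        rw [QuotientGroup.eq]
        have : (g * k * g'⁻¹ * g')⁻¹ * g = k⁻¹ := by group
        rw [this]
        exact inv_mem hk
  refine Nat.card_congr (Equiv.ofBijective (Quotient.map' F fun y y' h => (hF y y').mp h) ⟨?_, ?_⟩)
  · intro o1 o2
    induction o1 using Quotient.inductionOn'
    induction o2 using Quotient.inductionOn'
    intro h
    exact Quotient.sound' ((hF _ _).mpr (Quotient.exact' h))
  · intro o
    induction o using Quotient.inductionOn'
    rename_i f
    obtain ⟨M, R, hR, ha, hM⟩ := exists_stretch hD.out hD4 hp f.2
    let c : SL2Z ⧸ CongruenceSubgroup.Gamma0 p := ((1 : SL2Z) : SL2Z ⧸ CongruenceSubgroup.Gamma0 p)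
    have hc : NR p R c := by
      rw [NR_mk, bqfAct_one]; exact ha
    refine ⟨Quotient.mk'' ⟨(⟨R, hR⟩, c), hc⟩, ?_⟩
    refine Quotient.sound' (Setoid.symm' _ ((orbitRel_iff _ _).mpr ?_))
    have o1 : ((1 : SL2Z) : SL2Z ⧸ CongruenceSubgroup.Gamma0 p) = c.out := (Quotient.out_eq' c).symm
    rw [QuotientGroup.eq, inv_one, one_mul] at o1
    obtain ⟨N, hN⟩ := (stretch_equiv_iff hp ha).mpr ⟨_, o1, rfl⟩
    refine ⟨M * N, ?_⟩
    rw [bqfAct_mul, hM]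
    exact hN

theorem card_lineCond (p : ℕ) (hp : p.Prime) (f : ℤ × ℤ × ℤ) :
    (Nat.card {i : Option (ZMod p) // lineCond p f i} : ℤ) =
      (if (f.1 : ZMod p) = 0 then 0 else 1) + (p -
        Nat.card {i : ZMod p // (f.1 : ZMod p) * i ^ 2 + f.2.1 * i + f.2.2 = 0}) := by
  have : Fact p.Prime := ⟨hp⟩
  rw [Nat.card_eq_fintype_card, Fintype.card_subtype, Finset.card_filter, Fintype.sum_option]
  push_cast
  congr 1
  · by_cases h0 : (f.1 : ZMod p) = 0 <;> simp [lineCond, h0]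
  · have h1 := Finset.card_filter_add_card_filter_not (s := (Finset.univ : Finset (ZMod p)))
      (fun i => (f.1 : ZMod p) * i ^ 2 + f.2.1 * i + f.2.2 = 0)
    rw [Finset.card_univ, ZMod.card] at h1
    rw [Nat.card_eq_fintype_card, Fintype.card_subtype]
    have h2 : (∑ i : ZMod p, if lineCond p f (some i) then (1 : ℤ) else 0) =
        ((Finset.univ.filter fun i : ZMod p =>
          ¬ (f.1 : ZMod p) * i ^ 2 + f.2.1 * i + f.2.2 = 0).card : ℤ) := by
      rw [Finset.card_filter]
      push_cast
      refine Finset.sum_congr rfl fun i _ => ?_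
      by_cases h0 : (f.1 : ZMod p) * i ^ 2 + f.2.1 * i + f.2.2 = 0 <;> simp [lineCond, h0]
    rw [h2]
    omega

theorem kroneckerSym_two (D : ℤ) : kroneckerSym D 2 = kron2 D := by
  simp [kroneckerSym]

theorem kroneckerSym_odd (D : ℤ) {p : ℕ} [hp : Fact p.Prime] (h2 : p ≠ 2) :
    kroneckerSym D p = quadraticChar (ZMod p) D := by
  have : padicValNat 2 p = 0 := by
    apply padicValNat.eq_zero_of_not_dvd
    intro h
    exact h2 ((Nat.prime_dvd_prime_iff_eq Nat.prime_two hp.out).mp h).symm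
  rw [kroneckerSym, this]
  simp only [pow_zero, one_mul, Nat.div_one]
  rw [← jacobiSym.legendreSym.to_jacobiSym, legendreSym]

theorem card_roots_odd {p : ℕ} [hp : Fact p.Prime] (h2 : p ≠ 2) (a b c : ZMod p) (ha : a ≠ 0) :
    (Nat.card {i : ZMod p // a * i ^ 2 + b * i + c = 0} : ℤ) =
      quadraticChar (ZMod p) (b ^ 2 - 4 * a * c) + 1 := by
  have hc : ringChar (ZMod p) ≠ 2 := by rwa [ZMod.ringChar_zmod_n]
  have h20 : (2 : ZMod p) ≠ 0 := Ring.two_ne_zero hc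
  rw [← quadraticChar_card_sqrts hc, Set.toFinset_card, ← Nat.card_eq_fintype_card]
  congr 1
  have h2a : 2 * a ≠ 0 := mul_ne_zero h20 ha
  refine Nat.card_congr (Equiv.subtypeEquiv
    ((Equiv.mulLeft₀ (2 * a) h2a).trans (Equiv.addRight b)) fun i => ?_)
  simp only [Equiv.trans_apply, Equiv.mulLeft₀_apply, Equiv.coe_addRight, Set.mem_ofPred_eq]
  constructor
  · intro h
    linear_combination 4 * a * h
  · intro h
    have : (2 * a) * (2 * (a * i ^ 2 + b * i + c)) = 0 := by linear_combination h
    exact (mul_eq_zero.mp ((mul_eq_zero.mp this).resolve_left h2a)).resolve_left h20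

theorem card_lineCond_eq {D : ℤ} (p : ℕ) (hp : p.Prime) {f : ℤ × ℤ × ℤ}
    (hf : IsPrimPosDefBQF D f) :
    (Nat.card {i : Option (ZMod p) // lineCond p f i} : ℤ) = p - kroneckerSym D p := by
  have : Fact p.Prime := ⟨hp⟩
  have hp' := Nat.prime_iff_prime_int.mp hp
  rw [card_lineCond p hp]
  obtain ⟨a, b, c⟩ := f
  obtain ⟨h1, hprim, h3⟩ := hf
  rw [prim_iff] at hprim
  simp only at h1 hprim h3 ⊢
  have hprim' : ¬ ((a : ZMod p) = 0 ∧ (b : ZMod p) = 0 ∧ (c : ZMod p) = 0) := by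
    simp only [ZMod.intCast_zmod_eq_zero_iff_dvd]
    exact fun h => hp'.not_dvd_one (hprim p h.1 h.2.1 h.2.2)
  by_cases h2 : p = 2
  · subst h2
    rw [kroneckerSym_two, Nat.card_eq_fintype_card, Fintype.card_subtype, Finset.card_filter]
    have hu : (Finset.univ : Finset (ZMod 2)) = {0, 1} := rfl
    rw [hu, Finset.sum_pair zero_ne_one]
    have hcast : ∀ n : ℤ, (n : ZMod 2) = 0 ↔ n % 2 = 0 := fun n => by
      rw [ZMod.intCast_zmod_eq_zero_iff_dvd]; simp only [Nat.cast_ofNat]; omega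
    have e0 : (a : ZMod 2) * 0 ^ 2 + b * 0 + c = (c : ℤ) := by simp
    have e1 : (a : ZMod 2) * 1 ^ 2 + b * 1 + c = ((a + b + c : ℤ) : ZMod 2) := by push_cast; ring
    rw [e0, e1]
    simp only [hcast] at hprim' ⊢
    unfold kron2
    rw [← h1]
    obtain ⟨a', ha⟩ : ∃ a', a = 2 * a' + a % 2 := ⟨a / 2, by omega⟩
    obtain ⟨c', hc⟩ : ∃ c', c = 2 * c' + c % 2 := ⟨c / 2, by omega⟩
    have hac : ∃ k, 4 * a * c = 8 * k + 4 * ((a % 2) * (c % 2)) := by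
      generalize a % 2 = r at *
      generalize c % 2 = s at *
      subst ha hc
      exact ⟨2 * a' * c' + a' * s + c' * r, by ring⟩
    have hb8 : (b % 2 = 0 ∧ b ^ 2 % 4 = 0) ∨ (b % 2 = 1 ∧ b ^ 2 % 8 = 1) := by
      rcases Int.even_or_odd' b with ⟨k, rfl | rfl⟩
      · left; refine ⟨by omega, ?_⟩; ring_nf; omega
      · right
        refine ⟨by omega, ?_⟩
        obtain ⟨l, hl⟩ := Int.even_mul_succ_self k
        have : (2 * k + 1) ^ 2 = 8 * l + 1 := by linear_combination 4 * hl
        omega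
    obtain ⟨k, hk⟩ := hac
    rw [hk]
    generalize b ^ 2 = B at *
    have ra : a % 2 = 0 ∨ a % 2 = 1 := by omega
    have rc : c % 2 = 0 ∨ c % 2 = 1 := by omega
    clear hk ha hc hprim h1
    rcases ra with ra | ra <;> rcases rc with rc | rc <;> rw [ra, rc] <;>
      split_ifs <;> push_cast <;> omega
  · rw [kroneckerSym_odd D h2]
    have hDc : (D : ZMod p) = (b : ZMod p) ^ 2 - 4 * a * c := by rw [← h1]; push_cast; ring
    by_cases ha : (a : ZMod p) = 0
    · rw [if_pos ha, hDc, ha]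
      by_cases hb : (b : ZMod p) = 0
      · have hc : (c : ZMod p) ≠ 0 := fun hc => hprim' ⟨ha, hb, hc⟩
        have : IsEmpty {i : ZMod p // 0 * i ^ 2 + (b : ZMod p) * i + c = 0} :=
          ⟨fun i => hc (by simpa [hb] using i.2)⟩
        rw [Nat.card_of_isEmpty, hb]
        simp
      · have : Nat.card {i : ZMod p // 0 * i ^ 2 + (b : ZMod p) * i + c = 0} = 1 := by
          rw [Nat.card_eq_one_iff_unique]
          constructor
          · constructor
            rintro ⟨x, hx⟩ ⟨y, hy⟩
            apply Subtype.ext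
            apply mul_left_cancel₀ hb
            linear_combination hx - hy
          · refine ⟨⟨-c / b, ?_⟩⟩
            field_simp
            ring
        rw [this]
        have : quadraticChar (ZMod p) ((b : ZMod p) ^ 2 - 4 * 0 * c) = 1 := by
          rw [mul_zero, zero_mul, sub_zero]
          exact quadraticChar_sq_one' hb
        rw [this]
        push_cast
        ring
    · rw [if_neg ha, card_roots_odd h2 _ _ _ ha, hDc]
      ring

theorem kroneckerSym_le_one (D : ℤ) {p : ℕ} (hp : p.Prime) : kroneckerSym D p ≤ 1 := by
  have : Fact p.Prime := ⟨hp⟩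
  by_cases h2 : p = 2
  · subst h2
    rw [kroneckerSym_two, kron2]
    split_ifs <;> norm_num
  · rw [kroneckerSym_odd D h2]
    by_cases h : (D : ZMod p) = 0
    · rw [h]; simp
    · rcases quadraticChar_dichotomy h with h | h <;> rw [h]; norm_num

theorem classNum_mul_prime_sq {D : ℤ} (hD : D < 0) (hD4 : D % 4 = 0 ∨ D % 4 = 1) {p : ℕ}
    (hp : p.Prime) : (classNum (D * (p : ℤ) ^ 2) : ℤ) * wAut D =
      classNum D * ((p - kroneckerSym D p) * 2) := by
  have hDp : D * (p : ℤ) ^ 2 < 0 := by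
    have : 0 < (p : ℤ) := by exact_mod_cast hp.pos
    have : 0 < (p : ℤ) ^ 2 := by positivity
    nlinarith
  have : Fact (D < 0) := ⟨hD⟩
  have : Fact (D * (p : ℤ) ^ 2 < 0) := ⟨hDp⟩
  have hpos : 0 < (p : ℤ) - kroneckerSym D p := by
    have := kroneckerSym_le_one D hp
    have : (2 : ℤ) ≤ p := by exact_mod_cast hp.two_le
    linarith
  obtain ⟨n, hn⟩ := Int.eq_ofNat_of_zero_le hpos.le
  rw [hn] at hpos ⊢
  have h := orbit_count (G := SL2Z) (fun y : YY D p => y.1.1) (fun _ _ => rfl) (wAut D) 2 n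
    (by unfold wAut; split_ifs <;> norm_num) (by norm_num) (by exact_mod_cast hpos)
    (card_stab_X hD4) (card_stab_Y hD4 hp) (fun x => by
      rw [card_fiber p hp x]
      have := card_lineCond_eq p hp x.2
      rw [hn] at this
      exact_mod_cast this)
  rw [card_orbits_YY hD4 hp, ← classNum_eq, ← classNum_eq] at h
  exact_mod_cast h

theorem kroneckerSym_mul_sq (d : ℤ) (a : ℕ) {p : ℕ} (hp : p.Prime) :
    kroneckerSym (d * (a : ℤ) ^ 2) p = if p ∣ a then 0 else kroneckerSym d p := by
  have : Fact p.Prime := ⟨hp⟩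
  by_cases h2 : p = 2
  · subst h2
    rw [kroneckerSym_two, kroneckerSym_two]
    split_ifs with h
    · obtain ⟨k, rfl⟩ := h
      have : d * ((2 * k : ℕ) : ℤ) ^ 2 = 2 * (2 * d * (k : ℤ) ^ 2) := by push_cast; ring
      rw [this, kron2, if_pos (by omega)]
    · have ho : Odd a := by
        rw [← Nat.not_even_iff_odd, even_iff_two_dvd]; exact h
      obtain ⟨k, rfl⟩ := ho
      obtain ⟨l, hl⟩ := Int.even_mul_succ_self (k : ℤ)
      have : d * ((2 * k + 1 : ℕ) : ℤ) ^ 2 = d + 8 * (d * l) := by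
        push_cast; linear_combination 4 * d * hl
      rw [this, kron2, kron2]
      have e1 : (d + 8 * (d * l)) % 2 = d % 2 := by omega
      have e2 : (d + 8 * (d * l)) % 8 = d % 8 := by omega
      rw [e1, e2]
  · rw [kroneckerSym_odd _ h2, kroneckerSym_odd _ h2]
    push_cast
    rw [map_mul]
    split_ifs with h
    · rw [(ZMod.natCast_eq_zero_iff a p).mpr h]; simp
    · rw [quadraticChar_sq_one' (fun h' => h ((ZMod.natCast_eq_zero_iff a p).mp h')), mul_one]

theorem disc_mul_sq {d : ℤ} (h : d % 4 = 0 ∨ d % 4 = 1) (a : ℕ) :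
    d * (a : ℤ) ^ 2 % 4 = 0 ∨ d * (a : ℤ) ^ 2 % 4 = 1 := by
  rcases Int.even_or_odd' (a : ℤ) with ⟨k, hk | hk⟩
  · left
    rw [hk]
    have : d * (2 * k) ^ 2 = 4 * (d * k ^ 2) := by ring
    omega
  · rw [hk]
    have : d * (2 * k + 1) ^ 2 = d + 4 * (d * k ^ 2 + d * k) := by ring
    omega

theorem wAut_ne_zero (D : ℤ) : (wAut D : ℚ) ≠ 0 := by
  unfold wAut; split_ifs <;> norm_num

theorem classNum_mul_sq_aux (d : ℤ) (hd : d < 0) (hd4 : d % 4 = 0 ∨ d % 4 = 1)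
    (f : ℕ) (hf : 0 < f) :
    (classNum (d * (f : ℤ) ^ 2) : ℚ) * wAut d =
      (classNum d : ℚ) * wAut (d * (f : ℤ) ^ 2) * (f *
        ∏ p ∈ f.primeFactors, (1 - (kroneckerSym d p : ℚ) / (p : ℚ))) := by
  induction f using induction_on_primes with
  | zero => omega
  | one => simp
  | prime_mul p a hp ih =>
    have ha : 0 < a := Nat.pos_of_mul_pos_left hf
    specialize ih ha
    have hD : d * (a : ℤ) ^ 2 < 0 := by
      have : 0 < (a : ℤ) ^ 2 := by positivity
      nlinarith
    have hD4 := disc_mul_sq hd4 a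
    have step := classNum_mul_prime_sq hD hD4 hp
    have hw : wAut (d * (a : ℤ) ^ 2 * (p : ℤ) ^ 2) = 2 := by
      have hp2 : (2 : ℤ) ≤ p := by exact_mod_cast hp.two_le
      have hp4 : (4 : ℤ) ≤ (p : ℤ) ^ 2 := by nlinarith
      have hD3 : d * (a : ℤ) ^ 2 ≤ -3 := by omega
      have : d * (a : ℤ) ^ 2 * (p : ℤ) ^ 2 ≤ -12 := by nlinarith
      rw [wAut, if_neg (by omega), if_neg (by omega)]
    have hcast : d * ((p * a : ℕ) : ℤ) ^ 2 = d * (a : ℤ) ^ 2 * (p : ℤ) ^ 2 := by push_cast; ring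
    rw [hcast, hw]
    generalize d * (a : ℤ) ^ 2 * (p : ℤ) ^ 2 = E at *
    have step' : (classNum E : ℚ) * wAut (d * (a : ℤ) ^ 2) =
      classNum (d * (a : ℤ) ^ 2) * ((p - kroneckerSym (d * (a : ℤ) ^ 2) p) * 2) := by
      exact_mod_cast step
    have hp0 : (p : ℚ) ≠ 0 := by exact_mod_cast hp.ne_zero
    have hprod : ((p * a : ℕ) : ℚ) *
        ∏ q ∈ (p * a).primeFactors, (1 - (kroneckerSym d q : ℚ) / (q : ℚ)) =
        (p - (kroneckerSym (d * (a : ℤ) ^ 2) p : ℚ)) * (a *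
          ∏ q ∈ a.primeFactors, (1 - (kroneckerSym d q : ℚ) / (q : ℚ))) := by
      rw [kroneckerSym_mul_sq d a hp, Nat.primeFactors_mul hp.ne_zero ha.ne', hp.primeFactors]
      by_cases hpa : p ∣ a
      · have : ({p} : Finset ℕ) ∪ a.primeFactors = a.primeFactors := by
          apply Finset.union_eq_right.mpr
          simp [hp, hpa, ha.ne']
        rw [this, if_pos hpa]
        push_cast
        ring
      · rw [if_neg hpa, Finset.singleton_union, Finset.prod_insert (by simp [hpa])]
        push_cast
        field_simp
    rw [hprod]
    generalize ((a : ℚ) * ∏ q ∈ a.primeFactors, (1 - (kroneckerSym d q : ℚ) / (q : ℚ))) = P at *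
    apply mul_right_cancel₀ (wAut_ne_zero (d * (a : ℤ) ^ 2))
    push_cast
    linear_combination (wAut d : ℚ) * step' +
      ((p - kroneckerSym (d * (a : ℤ) ^ 2) p) * 2 : ℚ) * ih

/-- Relation between the class number of a fundamental discriminant `d < 0`
and of `d f²`. -/
theorem classNum_mul_sq (d : ℤ) (hd : d < 0) (hfund : IsFundamentalDisc d)
    (f : ℕ) (hf : 0 < f) :
    (classNum (d * (f : ℤ) ^ 2) : ℚ) =
      (classNum d : ℚ) * (f : ℚ) / ((wAut d : ℚ) / (wAut (d * (f : ℤ) ^ 2) : ℚ)) *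
        ∏ p ∈ f.primeFactors, (1 - (kroneckerSym d p : ℚ) / (p : ℚ)) := by
  have h4 : d % 4 = 0 ∨ d % 4 = 1 := by
    rcases hfund with h | h
    · exact Or.inr h.1
    · exact Or.inl h.1
  have h := classNum_mul_sq_aux d hd h4 f hf
  have h1 := wAut_ne_zero d
  have h2 := wAut_ne_zero (d * (f : ℤ) ^ 2)
  rw [div_div_eq_mul_div, div_mul_eq_mul_div, eq_div_iff h1, h]
  ring
end

section
/- Let N ∈ ℕ with N ≡ 0 or 3 (mod 4), let d be the discriminant of ℚ(√−N), and let F ∈ ℕ be defined by −N = dF². Then H(N) = (h(d)/(w_d/2)) · ∏_p (p^{ord_p(F)+1} − 1 − (d/p)·(p^{ord_p(F)} − 1))/(p − 1), where the product runs over all primes p (all but finitely many factors equal 1) and (d/p) is the Kronecker symbol. -/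
open scoped BigOperators Classical
open Matrix Filter

namespace HCN

abbrev M2 := Matrix (Fin 2) (Fin 2) ℤ
abbrev SL := Matrix.SpecialLinearGroup (Fin 2) ℤ

/-- Substitution of the matrix `M` in the form `f`. -/
def app (f : ℤ × ℤ × ℤ) (M : M2) : ℤ × ℤ × ℤ :=
  (f.1 * M 0 0 ^ 2 + f.2.1 * M 0 0 * M 1 0 + f.2.2 * M 1 0 ^ 2,
   2 * f.1 * M 0 0 * M 0 1 + f.2.1 * (M 0 0 * M 1 1 + M 0 1 * M 1 0) + 2 * f.2.2 * M 1 0 * M 1 1,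
   f.1 * M 0 1 ^ 2 + f.2.1 * M 0 1 * M 1 1 + f.2.2 * M 1 1 ^ 2)

def disc (f : ℤ × ℤ × ℤ) : ℤ := f.2.1 ^ 2 - 4 * f.1 * f.2.2

def Prim (f : ℤ × ℤ × ℤ) : Prop := ∀ q : ℕ, q.Prime → (q : ℤ) ∣ f.1 → (q : ℤ) ∣ f.2.1 → ¬ (q : ℤ) ∣ f.2.2

lemma app_mul (f : ℤ × ℤ × ℤ) (M N : M2) : app f (M * N) = app (app f M) N := by
  simp only [app, Matrix.mul_apply, Fin.sum_univ_two, Prod.mk.injEq]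
  refine ⟨?_, ?_, ?_⟩ <;> ring

lemma app_one (f : ℤ × ℤ × ℤ) : app f 1 = f := by
  obtain ⟨a, b, c⟩ := f
  simp [app]

lemma disc_app (f : ℤ × ℤ × ℤ) (M : M2) : disc (app f M) = M.det ^ 2 * disc f := by
  simp only [app, disc, Matrix.det_fin_two]; ring

lemma bqfEquiv_iff (f g : ℤ × ℤ × ℤ) : BQFEquiv f g ↔ ∃ M : SL, app f M = g := by
  obtain ⟨a, b, c⟩ := g
  unfold BQFEquiv app
  simp only [Prod.mk.injEq]
  exact exists_congr fun M => ⟨fun ⟨h1, h2, h3⟩ => ⟨h1.symm, h2.symm, h3.symm⟩,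
    fun ⟨h1, h2, h3⟩ => ⟨h1.symm, h2.symm, h3.symm⟩⟩

lemma isPrim_iff (d : ℤ) (f : ℤ × ℤ × ℤ) : IsPrimPosDefBQF d f ↔ disc f = d ∧ Prim f ∧ 0 < f.1 := by
  unfold IsPrimPosDefBQF disc
  refine and_congr_right fun _ => and_congr_left fun _ => ?_
  constructor
  · intro h q hq h1 h2 h3
    have : q ∣ Int.gcd f.1 (Int.gcd f.2.1 f.2.2) :=
      Int.dvd_gcd h1 (by exact_mod_cast Int.dvd_gcd h2 h3)
    rw [h] at this
    exact hq.one_lt.ne' (Nat.dvd_one.1 this)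
  · intro h
    by_contra hne
    obtain ⟨q, hq, hd⟩ := Nat.exists_prime_and_dvd hne
    have hd' : (q : ℤ) ∣ (Int.gcd f.1 (Int.gcd f.2.1 f.2.2) : ℤ) := by exact_mod_cast hd
    have h2 := hd'.trans (Int.gcd_dvd_right f.1 (Int.gcd f.2.1 f.2.2))
    exact h q hq (hd'.trans (Int.gcd_dvd_left _ _))
      (h2.trans (Int.gcd_dvd_left _ _)) (h2.trans (Int.gcd_dvd_right _ _))

lemma dvd_app {q : ℤ} {f : ℤ × ℤ × ℤ} (M : M2) (h1 : q ∣ f.1) (h2 : q ∣ f.2.1) (h3 : q ∣ f.2.2) :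
    q ∣ (app f M).1 ∧ q ∣ (app f M).2.1 ∧ q ∣ (app f M).2.2 := by
  obtain ⟨a, ha⟩ := h1
  obtain ⟨b, hb⟩ := h2
  obtain ⟨c, hc⟩ := h3
  simp only [app, ha, hb, hc]
  refine ⟨⟨(a * M 0 0 ^ 2 + b * M 0 0 * M 1 0 + c * M 1 0 ^ 2), by ring⟩,
   ⟨2 * a * M 0 0 * M 0 1 + b * (M 0 0 * M 1 1 + M 0 1 * M 1 0) + 2 * c * M 1 0 * M 1 1, by ring⟩,
   ⟨a * M 0 1 ^ 2 + b * M 0 1 * M 1 1 + c * M 1 1 ^ 2, by ring⟩⟩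

/-- primitivity descends -/
lemma prim_of_app {f : ℤ × ℤ × ℤ} (M : M2) (h : Prim (app f M)) : Prim f := by
  intro q hq h1 h2 h3
  obtain ⟨a, b, c⟩ := dvd_app M h1 h2 h3
  exact h q hq a b c

lemma app_inv (f : ℤ × ℤ × ℤ) (M : SL) : app (app f M) (M⁻¹ : SL) = f := by
  rw [← app_mul, ← Matrix.SpecialLinearGroup.coe_mul, mul_inv_cancel,
    Matrix.SpecialLinearGroup.coe_one, app_one]

lemma app_inv' (f : ℤ × ℤ × ℤ) (M : SL) : app (app f (M⁻¹ : SL)) M = f := by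
  simpa using app_inv f M⁻¹

lemma pos_app {f : ℤ × ℤ × ℤ} (hd : disc f < 0) (ha : 0 < f.1) (M : M2) (hM : M.det ≠ 0) :
    0 < (app f M).1 := by
  obtain ⟨a, b, c⟩ := f
  simp only [app, disc] at *
  set x := M 0 0
  set y := M 1 0
  have hxy : x ≠ 0 ∨ y ≠ 0 := by
    by_contra h
    push Not at h
    apply hM
    rw [Matrix.det_fin_two]
    show x * _ - _ * y = 0
    rw [h.1, h.2]; ring
  have key : 4 * a * (a * x ^ 2 + b * x * y + c * y ^ 2) =
      (2 * a * x + b * y) ^ 2 + (-(b ^ 2 - 4 * a * c)) * y ^ 2 := by ring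
  have hpos : 0 < (2 * a * x + b * y) ^ 2 + (-(b ^ 2 - 4 * a * c)) * y ^ 2 := by
    by_cases hy : y = 0
    · have hx : x ≠ 0 := by tauto
      rw [hy]
      have : 2 * a * x + b * 0 ≠ 0 := by
        rw [mul_zero, add_zero]
        exact mul_ne_zero (by omega) hx
      have := sq_pos_of_ne_zero this
      simpa using this
    · have := sq_pos_of_ne_zero hy
      have := mul_pos (by omega : 0 < -(b ^ 2 - 4 * a * c)) this
      have := sq_nonneg (2 * a * x + b * y)
      linarith
  rw [← key] at hpos
  exact pos_of_mul_pos_right hpos (by omega)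

abbrev X (D : ℤ) := {f : ℤ × ℤ × ℤ // IsPrimPosDefBQF D f}

lemma isPrim_app_SL {D : ℤ} (hD : D < 0) {f : ℤ × ℤ × ℤ} (hf : IsPrimPosDefBQF D f) (M : SL) :
    IsPrimPosDefBQF D (app f M) := by
  rw [isPrim_iff] at *
  refine ⟨by rw [disc_app, M.det_coe, hf.1]; ring, ?_, pos_app (hf.1 ▸ hD) hf.2.2 _ (by simp)⟩
  apply prim_of_app (M⁻¹ : SL)
  rw [app_inv]; exact hf.2.1

instance sX (D : ℤ) : Setoid (X D) where
  r f g := BQFEquiv f.1 g.1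
  iseqv := by
    refine ⟨fun f => (bqfEquiv_iff _ _).2 ⟨1, by simp [app_one]⟩, ?_, ?_⟩
    · intro f g h
      obtain ⟨M, hM⟩ := (bqfEquiv_iff _ _).1 h
      exact (bqfEquiv_iff _ _).2 ⟨M⁻¹, by rw [← hM, app_inv]⟩
    · intro f g k h h'
      obtain ⟨M, hM⟩ := (bqfEquiv_iff _ _).1 h
      obtain ⟨M', hM'⟩ := (bqfEquiv_iff _ _).1 h'
      exact (bqfEquiv_iff _ _).2 ⟨M * M', by
        rw [Matrix.SpecialLinearGroup.coe_mul, app_mul, hM, hM']⟩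

/-- The set of classes. -/
abbrev Cl (D : ℤ) := Quotient (sX D)

lemma classNum_eq (D : ℤ) : classNum D = Nat.card (Cl D) := rfl

lemma mk_eq_iff {D : ℤ} (f g : X D) : (⟦f⟧ : Cl D) = ⟦g⟧ ↔ ∃ M : SL, app f.1 M = g.1 := by
  rw [Quotient.eq]; exact bqfEquiv_iff _ _

lemma out_ex {D : ℤ} (f : X D) : ∃ M : SL, app f.1 M = (⟦f⟧ : Cl D).out.1 := by
  rw [← mk_eq_iff, Quotient.out_eq]

/-! ### automorphs -/

def Pell (D : ℤ) := {x : ℤ × ℤ // x.1 ^ 2 - D * x.2 ^ 2 = 4}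

lemma card_pell (D : ℤ) (hD : D < 0) (hm : D % 4 = 0 ∨ D % 4 = 1) : Nat.card (Pell D) = wAut D := by
  have key : ∀ S : Finset (ℤ × ℤ), (∀ x : ℤ × ℤ, x.1 ^ 2 - D * x.2 ^ 2 = 4 ↔ x ∈ S) →
      Nat.card (Pell D) = S.card := by
    intro S hS
    unfold Pell
    simp_rw [hS]
    simp
  have bd : ∀ x : ℤ × ℤ, x.1 ^ 2 - D * x.2 ^ 2 = 4 → -2 ≤ x.1 ∧ x.1 ≤ 2 ∧ -1 ≤ x.2 ∧ x.2 ≤ 1 := by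
    intro x hx
    have hD3 : D ≤ -3 := by omega
    have h1 : x.2 ^ 2 ≤ 1 := by nlinarith [sq_nonneg x.1, sq_nonneg x.2]
    have h2 : x.1 ^ 2 ≤ 4 := by nlinarith [sq_nonneg x.2]
    refine ⟨?_, ?_, ?_, ?_⟩ <;> nlinarith
  unfold wAut
  split_ifs with h3 h4
  · subst h3
    rw [key {(2,0),(-2,0),(1,1),(1,-1),(-1,1),(-1,-1)}]
    · rfl
    · rintro ⟨t, u⟩
      constructor
      · intro h
        obtain ⟨a, b, c, d⟩ := bd _ h
        simp only at a b c d h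
        interval_cases t <;> interval_cases u <;> simp at h ⊢
      · intro h
        simp only [Finset.mem_insert, Finset.mem_singleton, Prod.mk.injEq] at h
        rcases h with h | h | h | h | h | h <;> simp [h.1, h.2]
  · subst h4
    rw [key {(2,0),(-2,0),(0,1),(0,-1)}]
    · rfl
    · rintro ⟨t, u⟩
      constructor
      · intro h
        obtain ⟨a, b, c, d⟩ := bd _ h
        simp only at a b c d h
        interval_cases t <;> interval_cases u <;> simp at h ⊢
      · intro h
        simp only [Finset.mem_insert, Finset.mem_singleton, Prod.mk.injEq] at h
        rcases h with h | h | h | h <;> simp [h.1, h.2]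
  · rw [key {(2,0),(-2,0)}]
    · rfl
    · rintro ⟨t, u⟩
      constructor
      · intro h
        obtain ⟨a, b, c, d⟩ := bd _ h
        simp only at a b c d h
        interval_cases t <;> interval_cases u <;> simp at h ⊢ <;> omega
      · intro h
        simp only [Finset.mem_insert, Finset.mem_singleton, Prod.mk.injEq] at h
        rcases h with h | h <;> simp [h.1, h.2]

lemma wAut_ne (D : ℤ) : wAut D ≠ 0 := by unfold wAut; split_ifs <;> norm_num

lemma stab_eqs {a b c α β γ δ : ℤ} (hdet : α * δ - β * γ = 1)
    (h1 : a * α ^ 2 + b * α * γ + c * γ ^ 2 = a)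
    (h2 : 2 * a * α * β + b * (α * δ + β * γ) + 2 * c * γ * δ = b)
    (h3 : a * β ^ 2 + b * β * δ + c * δ ^ 2 = c) :
    a * (δ - α) = b * γ ∧ a * β = - (c * γ) ∧ c * (δ - α) = - (b * β) := by
  have h2' : a * α * β + b * β * γ + c * γ * δ = 0 := by
    have : 2 * (a * α * β + b * β * γ + c * γ * δ) = 0 := by linear_combination h2 - b * hdet
    omega
  refine ⟨?_, ?_, ?_⟩
  · linear_combination (-δ) * h1 + γ * h2' + a * α * hdet + b * γ * hdet
  · linear_combination (-β) * h1 + α * h2' - c * γ * hdet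
  · linear_combination α * h3 - β * h2' - c * δ * hdet - b * β * hdet

lemma prim_dvd {a b c g : ℤ} (hp : Prim (a, b, c)) (ha : 0 < a) (h1 : a ∣ b * g) (h2 : a ∣ c * g) :
    a ∣ g := by
  have hg : Int.gcd a (Int.gcd b c) = 1 :=
    ((isPrim_iff (disc (a, b, c)) (a, b, c)).2 ⟨rfl, hp, ha⟩).2.1
  have h3 : a ∣ (Int.gcd b c : ℤ) * g := by
    rw [Int.gcd_eq_gcd_ab b c, add_mul]
    refine dvd_add ?_ ?_
    · rw [mul_right_comm]; exact h1.mul_right _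
    · rw [mul_right_comm]; exact h2.mul_right _
  exact Int.dvd_of_dvd_mul_right_of_gcd_one h3 hg

lemma card_stab {D : ℤ} (hD : D < 0) {f : ℤ × ℤ × ℤ} (hf : IsPrimPosDefBQF D f) :
    Nat.card {M : SL // app f M = f} = wAut D := by
  rw [isPrim_iff] at hf
  obtain ⟨a, b, c⟩ := f
  obtain ⟨hdisc, hprim, ha⟩ := hf
  simp only [disc] at hdisc
  simp only at ha
  have hm : D % 4 = 0 ∨ D % 4 = 1 := by
    have : D = b ^ 2 - 4 * (a * c) := by rw [← hdisc]; ring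
    rcases Int.even_or_odd' b with ⟨k, hk | hk⟩ <;> rw [hk] at this <;> ring_nf at this <;> omega
  rw [← card_pell D hD hm]
  have hpar : ∀ x : Pell D, ∃ s, x.1.1 = 2 * s + b * x.1.2 := by
    rintro ⟨⟨t, u⟩, h⟩
    simp only at h ⊢
    have : Even ((t - b * u) * (t + b * u)) := ⟨2 - 2 * a * c * u ^ 2, by
      linear_combination h + u ^ 2 * hdisc.symm⟩
    have : Even (t - b * u) := by
      rw [Int.even_mul] at this
      rcases this with h | h
      · exact h
      · have : t - b * u = t + b * u - 2 * (b * u) := by ring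
        rw [this]; exact h.sub (even_two_mul _)
    obtain ⟨s, hs⟩ := this
    exact ⟨s, by linarith⟩
  choose s hs using hpar
  symm
  refine Nat.card_congr (Equiv.ofBijective (fun x => ⟨⟨!![s x, -c * x.1.2; a * x.1.2, s x + b * x.1.2], ?_⟩, ?_⟩) ⟨?_, ?_⟩)
  · rw [Matrix.det_fin_two_of]
    have h1 := hs x
    have h2 := x.2
    rw [h1] at h2
    have : 4 * (s x * (s x + b * x.1.2) - -c * x.1.2 * (a * x.1.2)) = 4 * 1 := by
      linear_combination h2 - x.1.2 ^ 2 * hdisc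
    omega
  · have h1 := hs x
    have h2 := x.2
    rw [h1] at h2
    have : (s x * (s x + b * x.1.2) - -c * x.1.2 * (a * x.1.2)) = 1 := by
      have : 4 * (s x * (s x + b * x.1.2) - -c * x.1.2 * (a * x.1.2)) = 4 * 1 := by
        linear_combination h2 - x.1.2 ^ 2 * hdisc
      omega
    simp only [app, Matrix.of_apply, Matrix.cons_val', Matrix.cons_val_zero, Matrix.cons_val_one,
      Matrix.cons_val_fin_one, Prod.mk.injEq]
    refine ⟨?_, ?_, ?_⟩
    · linear_combination a * this
    · linear_combination b * this
    · linear_combination c * this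
  · intro x y hxy
    have h1 := congrArg (fun z => (z.1.1 : M2) 0 0) hxy
    have h2 := congrArg (fun z => (z.1.1 : M2) 1 0) hxy
    simp at h1 h2
    have h3 : x.1.2 = y.1.2 := by
      rcases h2 with h | h
      · exact h
      · omega
    refine Subtype.ext (Prod.ext ?_ h3)
    rw [hs x, hs y, h1, h3]
  · rintro ⟨M, hM⟩
    have hdet : M 0 0 * M 1 1 - M 0 1 * M 1 0 = 1 := by
      rw [← Matrix.det_fin_two]; exact M.det_coe
    simp only [app, Prod.mk.injEq] at hM
    obtain ⟨e1, e2, e3⟩ := stab_eqs hdet hM.1 hM.2.1 hM.2.2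
    have hdv : a ∣ M 1 0 := by
      have k1 : a ∣ b * M 1 0 := Dvd.intro _ e1
      have k2 : a ∣ c * M 1 0 := Dvd.intro (- M 0 1) (by linarith)
      exact prim_dvd hprim ha k1 k2
    obtain ⟨u, hu⟩ := hdv
    have e4 : M 1 1 - M 0 0 = b * u := by
      apply mul_left_cancel₀ ha.ne'
      rw [e1, hu]; ring
    have e5 : M 0 1 = - c * u := by
      apply mul_left_cancel₀ ha.ne'
      rw [e2, hu]; ring
    refine ⟨⟨(M 0 0 + M 1 1, u), ?_⟩, ?_⟩
    · simp only
      rw [hu, e5] at hdet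
      linear_combination 4 * hdet - u ^ 2 * hdisc.symm + (M 1 1 - M 0 0 + b * u) * e4
    · have h1 := hs ⟨(M 0 0 + M 1 1, u), (by
        simp only
        rw [hu, e5] at hdet
        linear_combination 4 * hdet - u ^ 2 * hdisc.symm + (M 1 1 - M 0 0 + b * u) * e4)⟩
      simp only at h1
      apply Subtype.ext
      ext i j
      fin_cases i <;> fin_cases j <;> simp <;> linarith

/-- number of transporters -/
lemma card_trans {D : ℤ} (hD : D < 0) (f : X D) :
    Nat.card {M : SL // app f.1 M = (⟦f⟧ : Cl D).out.1} = wAut D := by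
  rw [← card_stab hD f.2]
  obtain ⟨M₀, hM₀⟩ := out_ex f
  refine Nat.card_congr ?_
  refine (Equiv.mulRight M₀⁻¹).subtypeEquiv ?_
  intro M
  simp only [Equiv.coe_mulRight, Matrix.SpecialLinearGroup.coe_mul, app_mul]
  constructor
  · intro h
    rw [h, ← hM₀, app_inv]
  · intro h
    rw [← hM₀, ← h, app_inv', h]

end HCN

namespace HCN

/-- Coset representatives of integral matrices of determinant `p`. -/
def T (p : ℕ) : Option (ZMod p) → M2
  | none => !![1, 0; 0, (p : ℤ)]
  | some j => !![(j.val : ℤ), -(p : ℤ); 1, 0]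

lemma det_T (p : ℕ) (j : Option (ZMod p)) : (T p j).det = p := by
  cases j <;> simp [T, Matrix.det_fin_two_of]

lemma T_cancel {p : ℕ} (hp : p.Prime) (j : Option (ZMod p)) {A B : M2} (h : T p j * A = T p j * B) :
    A = B := by
  have h2 := congrArg (fun Y => (T p j).adjugate * Y) h
  simp only [← mul_assoc, Matrix.adjugate_mul, det_T, Matrix.smul_mul, Matrix.one_mul] at h2
  ext a b
  have h3 := congrFun (congrFun h2 a) b
  simp only [Matrix.smul_apply, smul_eq_mul] at h3
  exact mul_left_cancel₀ (by exact_mod_cast hp.ne_zero) h3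

lemma val_dvd_iff {p : ℕ} [NeZero p] (j : ZMod p) (x y : ℤ) :
    (p : ℤ) ∣ x - j.val * y ↔ (x : ZMod p) = j * y := by
  rw [← ZMod.intCast_zmod_eq_zero_iff_dvd]
  push_cast
  rw [ZMod.natCast_zmod_val, sub_eq_zero]

lemma coset_exists {p : ℕ} (hp : p.Prime) (S : M2) (hS : S.det = p) :
    ∃ (j : Option (ZMod p)) (M : SL), T p j * M = S := by
  have := Fact.mk hp
  rw [Matrix.det_fin_two] at hS
  have hS' : (S 0 0 : ZMod p) * S 1 1 - S 0 1 * S 1 0 = 0 := by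
    have := congrArg (Int.cast : ℤ → ZMod p) hS
    push_cast at this
    simpa using this
  have hp0 : (p : ℤ) ≠ 0 := by exact_mod_cast hp.ne_zero
  have main : ((p : ℤ) ∣ S 1 0 ∧ (p : ℤ) ∣ S 1 1) ∨ ∃ j : ZMod p,
      (p : ℤ) ∣ S 0 0 - j.val * S 1 0 ∧ (p : ℤ) ∣ S 0 1 - j.val * S 1 1 := by
    simp_rw [val_dvd_iff, ← ZMod.intCast_zmod_eq_zero_iff_dvd]
    by_cases hz : (S 1 0 : ZMod p) = 0
    · by_cases hw : (S 1 1 : ZMod p) = 0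
      · exact Or.inl ⟨hz, hw⟩
      · refine Or.inr ⟨S 0 1 / S 1 1, ?_, ?_⟩
        · rw [hz] at hS' ⊢
          simp only [mul_zero, sub_zero, mul_eq_zero] at hS' ⊢
          tauto
        · field_simp
    · refine Or.inr ⟨S 0 0 / S 1 0, ?_, ?_⟩
      · field_simp
      · field_simp
        linear_combination -hS'
  rcases main with ⟨⟨z, hz⟩, ⟨w, hw⟩⟩ | ⟨j, ⟨z, hz⟩, ⟨w, hw⟩⟩
  · refine ⟨none, ⟨!![S 0 0, S 0 1; z, w], ?_⟩, ?_⟩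
    · rw [Matrix.det_fin_two_of]
      apply mul_left_cancel₀ hp0
      rw [hz, hw] at hS
      linear_combination hS
    · ext a b
      fin_cases a <;> fin_cases b <;> simp [T, Matrix.mul_apply, Fin.sum_univ_two, hz, hw]
  · refine ⟨some j, ⟨!![S 1 0, S 1 1; -z, -w], ?_⟩, ?_⟩
    · rw [Matrix.det_fin_two_of]
      apply mul_left_cancel₀ hp0
      linear_combination hS - S 1 1 * hz + S 1 0 * hw
    · ext a b
      fin_cases a <;> fin_cases b <;> simp [T, Matrix.mul_apply, Fin.sum_univ_two, -ZMod.natCast_val] <;> linarith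

lemma coset_unique {p : ℕ} (hp : p.Prime) {j k : Option (ZMod p)} {M M' : SL}
    (h : T p j * M = T p k * M') : j = k ∧ M = M' := by
  have hjk : j = k := by
    have := Fact.mk hp
    -- reduce to T k = T j * R
    have hR : T p k = T p j * (M * M'⁻¹ : SL) := by
      rw [Matrix.SpecialLinearGroup.coe_mul, ← mul_assoc, h, mul_assoc,
        ← Matrix.SpecialLinearGroup.coe_mul, mul_inv_cancel, Matrix.SpecialLinearGroup.coe_one,
        mul_one]
    have hR' : T p j = T p k * (M' * M⁻¹ : SL) := by
      rw [Matrix.SpecialLinearGroup.coe_mul, ← mul_assoc, ← h, mul_assoc,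
        ← Matrix.SpecialLinearGroup.coe_mul, mul_inv_cancel, Matrix.SpecialLinearGroup.coe_one,
        mul_one]
    generalize (M * M'⁻¹ : SL) = R at hR
    generalize (M' * M⁻¹ : SL) = R' at hR'
    have hone : ∀ (i : ZMod p) (R : SL), T p (some i) = T p none * R → False := by
      intro i R hR
      have h2 := congrFun (congrFun hR 1) 0
      simp [T, Matrix.mul_apply, Fin.sum_univ_two] at h2
      have : (p : ℤ) ∣ 1 := ⟨_, h2⟩
      have := Int.natCast_dvd_natCast.1 (this : (p : ℤ) ∣ ((1 : ℕ) : ℤ))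
      exact hp.one_lt.ne' (Nat.dvd_one.1 this)
    cases j with
    | none =>
      cases k with
      | none => rfl
      | some k => exact (hone k R hR).elim
    | some j =>
      cases k with
      | none => exact (hone j R' hR').elim
      | some k =>
        have h2 := congrFun (congrFun hR 1) 0
        have h3 := congrFun (congrFun hR 0) 0
        simp [T, Matrix.mul_apply, Fin.sum_univ_two] at h2 h3
        rw [← h2] at h3
        have := congrArg (Int.cast : ℤ → ZMod p) h3
        push_cast at this
        simp at this
        rw [this]
  subst hjk
  exact ⟨rfl, Matrix.SpecialLinearGroup.ext_iff _ _ |>.2 fun a b =>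
    congrFun (congrFun (T_cancel hp j h) a) b⟩

lemma app_smul (c : ℤ) (f : ℤ × ℤ × ℤ) (M : M2) : app (c • f) M = c • app f M := by
  simp only [app, Prod.smul_fst, Prod.smul_snd, smul_eq_mul, Prod.smul_mk, Prod.mk.injEq]
  refine ⟨?_, ?_, ?_⟩ <;> ring

lemma app_smul_mat (c : ℤ) (f : ℤ × ℤ × ℤ) (M : M2) : app f (c • M) = (c ^ 2) • app f M := by
  simp only [app, Matrix.smul_apply, smul_eq_mul, Prod.smul_mk, Prod.mk.injEq]
  refine ⟨?_, ?_, ?_⟩ <;> ring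

lemma app_T_adj (p : ℕ) (j : Option (ZMod p)) (f : ℤ × ℤ × ℤ) :
    app (app f (T p j)) (T p j).adjugate = ((p : ℤ) ^ 2) • f := by
  rw [← app_mul, Matrix.mul_adjugate, det_T, app_smul_mat, app_one]

lemma app_adj_T (p : ℕ) (j : Option (ZMod p)) (f : ℤ × ℤ × ℤ) :
    app (app f (T p j).adjugate) (T p j) = ((p : ℤ) ^ 2) • f := by
  rw [← app_mul, Matrix.adjugate_mul, det_T, app_smul_mat, app_one]

lemma smul_cancel {p : ℕ} (hp : p.Prime) {f g : ℤ × ℤ × ℤ} (h : ((p : ℤ) ^ 2) • f = ((p : ℤ) ^ 2) • g) :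
    f = g := by
  have hp0 : (p : ℤ) ^ 2 ≠ 0 := pow_ne_zero _ (by exact_mod_cast hp.ne_zero)
  obtain ⟨a, b, c⟩ := f
  obtain ⟨a', b', c'⟩ := g
  simp only [Prod.smul_mk, Prod.mk.injEq, smul_eq_mul] at h ⊢
  exact ⟨mul_left_cancel₀ hp0 h.1, mul_left_cancel₀ hp0 h.2.1, mul_left_cancel₀ hp0 h.2.2⟩

lemma card_sigma_const {ι : Type*} {F : ι → Type*} {n : ℕ} (hn : n ≠ 0)
    (h : ∀ i, Nat.card (F i) = n) : Nat.card (Σ i, F i) = Nat.card ι * n := by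
  have e : ∀ i, Nonempty (F i ≃ Fin n) := fun i => by
    have : Finite (F i) := Nat.finite_of_card_ne_zero (by rw [h i]; exact hn)
    exact ⟨Finite.equivFinOfCardEq (h i)⟩
  rw [Nat.card_congr ((Equiv.sigmaCongrRight fun i => (e i).some).trans (Equiv.sigmaEquivProd _ _)), Nat.card_prod]
  simp

/-! ### primitivity of sublattice forms -/

lemma app_T_none (p : ℕ) (a b c : ℤ) : app (a, b, c) (T p none) = (a, p * b, p ^ 2 * c) := by
  simp only [app, T, Matrix.of_apply, Matrix.cons_val', Matrix.cons_val_zero, Matrix.cons_val_one,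
      Matrix.cons_val_fin_one, Prod.mk.injEq]
  refine ⟨?_, ?_, ?_⟩ <;> ring

lemma app_T_some (p : ℕ) (j : ZMod p) (a b c : ℤ) : app (a, b, c) (T p (some j)) =
    (a * (j.val : ℤ) ^ 2 + b * j.val + c, - (p * (2 * a * j.val + b)), p ^ 2 * a) := by
  simp only [app, T, Matrix.of_apply, Matrix.cons_val', Matrix.cons_val_zero, Matrix.cons_val_one,
      Matrix.cons_val_fin_one, Prod.mk.injEq]
  refine ⟨?_, ?_, ?_⟩ <;> ring

lemma isPrim_T {p : ℕ} (hp : p.Prime) {D : ℤ} (hD : D < 0) {f : ℤ × ℤ × ℤ} (hf : IsPrimPosDefBQF D f)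
    (j : Option (ZMod p)) :
    IsPrimPosDefBQF (D * p ^ 2) (app f (T p j)) ↔ ¬ (p : ℤ) ∣ (app f (T p j)).1 := by
  rw [isPrim_iff] at *
  have hmid : (p : ℤ) ∣ (app f (T p j)).2.1 ∧ (p : ℤ) ∣ (app f (T p j)).2.2 := by
    obtain ⟨a, b, c⟩ := f
    cases j with
    | none =>
      rw [app_T_none]
      exact ⟨Dvd.intro _ rfl, Dvd.intro (p * c) (by ring)⟩
    | some j =>
      rw [app_T_some]
      exact ⟨Dvd.intro (-(2 * a * j.val + b)) (by ring), Dvd.intro (p * a) (by ring)⟩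
  constructor
  · intro h hd
    exact h.2.1 p hp hd hmid.1 hmid.2
  · intro h
    refine ⟨by rw [disc_app, det_T, hf.1]; ring, ?_, pos_app (hf.1 ▸ hD) hf.2.2 _
      (by rw [det_T]; exact_mod_cast hp.ne_zero)⟩
    intro q hq h1 h2 h3
    by_cases hqp : q = p
    · subst hqp; exact h h1
    · have h4 := dvd_app (T p j).adjugate h1 h2 h3
      rw [app_T_adj] at h4
      simp only [Prod.smul_fst, Prod.smul_snd, smul_eq_mul] at h4
      have hcop : IsCoprime (q : ℤ) ((p : ℤ) ^ 2) :=
        (Nat.isCoprime_iff_coprime.2 ((Nat.coprime_primes hq hp).2 hqp)).pow_right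
      exact hf.2.1 q hq (hcop.dvd_of_dvd_mul_left h4.1) (hcop.dvd_of_dvd_mul_left h4.2.1)
        (hcop.dvd_of_dvd_mul_left h4.2.2)

/-- Side 1 of the double count. -/
lemma side1 {p : ℕ} (hp : p.Prime) {D : ℤ} (hD : D < 0) (f : X D) :
    Nat.card {x : Cl (D * p ^ 2) × M2 // x.2.det = p ∧ app f.1 x.2 = x.1.out.1} =
      Nat.card {j : Option (ZMod p) // ¬ (p : ℤ) ∣ (app f.1 (T p j)).1} * wAut (D * p ^ 2) := by
  have hD' : D * p ^ 2 < 0 := mul_neg_of_neg_of_pos hD (pow_pos (by exact_mod_cast hp.pos) 2)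
  let g : {j : Option (ZMod p) // ¬ (p : ℤ) ∣ (app f.1 (T p j)).1} → X (D * p ^ 2) :=
    fun j => ⟨app f.1 (T p j.1), (isPrim_T hp hD f.2 j.1).2 j.2⟩
  rw [← card_sigma_const (wAut_ne _) (fun j => card_trans hD' (g j))]
  symm
  refine Nat.card_congr (Equiv.ofBijective
    (fun x => ⟨(⟦g x.1⟧, T p x.1.1 * x.2.1), ?_, ?_⟩) ⟨?_, ?_⟩)
  · simp [Matrix.det_mul, det_T]
  · simp only [app_mul]
    exact x.2.2
  · rintro ⟨j, M⟩ ⟨k, M'⟩ h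
    have h2 := congrArg (fun z => z.1.2) h
    simp only at h2
    obtain ⟨h3, h4⟩ := coset_unique hp h2
    have h3 : j = k := Subtype.ext h3
    subst h3
    have h4 : M = M' := Subtype.ext h4
    rw [h4]
  · rintro ⟨⟨q, S⟩, hS, hfS⟩
    simp only at hS hfS
    obtain ⟨j, M, rfl⟩ := coset_exists hp S hS
    rw [app_mul] at hfS
    have hpr : IsPrimPosDefBQF (D * p ^ 2) (app f.1 (T p j)) := by
      have := isPrim_app_SL hD' q.out.2 M⁻¹
      rwa [← hfS, app_inv] at this
    have hj := (isPrim_T hp hD f.2 j).1 hpr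
    have hq : q = ⟦g ⟨j, hj⟩⟧ := by
      rw [← q.out_eq, eq_comm, mk_eq_iff]
      exact ⟨M, hfS⟩
    subst hq
    exact ⟨⟨⟨j, hj⟩, ⟨M, hfS⟩⟩, rfl⟩

/-- Side 2 of the double count, given the unique superlattice. -/
lemma side2 {p : ℕ} (hp : p.Prime) {D : ℤ} (hD : D < 0) (g : X (D * p ^ 2))
    (hu : ∃! j, ∃ f : ℤ × ℤ × ℤ, app g.1 (T p j) = ((p : ℤ) ^ 2) • f) :
    Nat.card {x : Cl D × M2 // x.2.det = p ∧ app x.1.out.1 x.2 = g.1} = wAut D := by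
  have hp0 : (p : ℤ) ≠ 0 := by exact_mod_cast hp.ne_zero
  have hD' : D * p ^ 2 < 0 := mul_neg_of_neg_of_pos hD (pow_pos (by exact_mod_cast hp.pos) 2)
  obtain ⟨j, ⟨f, hf⟩, huniq⟩ := hu
  have hg := (isPrim_iff _ _).1 g.2
  have hfg : app f (T p j).adjugate = g.1 := by
    apply smul_cancel hp
    rw [← app_smul, ← hf, app_T_adj]
  have hfX : IsPrimPosDefBQF D f := by
    rw [isPrim_iff]
    refine ⟨?_, ?_, ?_⟩
    · have h1 := disc_app g.1 (T p j)
      rw [hf, det_T, hg.1] at h1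
      have : (p : ℤ) ^ 4 * disc f = (p : ℤ) ^ 4 * D := by
        rw [← show disc ((p : ℤ) ^ 2 • f) = (p : ℤ) ^ 4 * disc f from ?_, h1]
        · ring
        · simp only [disc, Prod.smul_fst, Prod.smul_snd, smul_eq_mul]; ring
      exact mul_left_cancel₀ (pow_ne_zero _ hp0) this
    · apply prim_of_app (T p j).adjugate
      rw [hfg]; exact hg.2.1
    · have h1 := pos_app (by rw [hg.1]; exact hD') hg.2.2 (T p j) (by rw [det_T]; exact hp0)
      rw [hf] at h1
      simp only [Prod.smul_fst, smul_eq_mul] at h1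
      exact pos_of_mul_pos_right h1 (by positivity)
  let f' : X D := ⟨f, hfX⟩
  rw [← card_trans hD f']
  symm
  refine Nat.card_congr (Equiv.ofBijective
    (fun M => ⟨(⟦f'⟧, (M.1⁻¹ : SL) * (T p j).adjugate), ?_, ?_⟩) ⟨?_, ?_⟩)
  · simp only [Matrix.det_mul, Matrix.det_adjugate, det_T, Matrix.SpecialLinearGroup.det_coe]
    simp
  · simp only [app_mul]
    obtain ⟨M, hM⟩ := M
    simp only
    rw [← hM, app_inv]
    exact hfg
  · intro M M' h
    have h2 := congrArg (fun z => z.1.2.adjugate) h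
    simp only [Matrix.adjugate_mul_distrib, Matrix.adjugate_adjugate', ← Matrix.SpecialLinearGroup.coe_inv] at h2
    simp only [inv_inv] at h2
    exact Subtype.ext (coset_unique hp (by simpa using h2)).2
  · rintro ⟨⟨q, S⟩, hS, hfS⟩
    simp only at hS hfS
    obtain ⟨k, M, hM⟩ := coset_exists hp S.adjugate (by simp [Matrix.det_adjugate, hS])
    have hS' : S = (M⁻¹ : SL) * (T p k).adjugate := by
      have := congrArg Matrix.adjugate hM
      rw [Matrix.adjugate_mul_distrib, Matrix.adjugate_adjugate'] at this
      rw [Matrix.SpecialLinearGroup.coe_inv, this]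
      simp
    rw [hS', app_mul] at hfS
    have h1 : app g.1 (T p k) = ((p : ℤ) ^ 2) • app q.out.1 (M⁻¹ : SL) := by
      rw [← hfS, app_adj_T]
    have hk := huniq k ⟨_, h1⟩
    subst hk
    rw [hf] at h1
    have h2 := smul_cancel hp h1
    have h3 : app f M = q.out.1 := by rw [h2, app_inv']
    have hq : q = ⟦f'⟧ := by
      rw [← q.out_eq, eq_comm, mk_eq_iff]
      exact ⟨M, h3⟩
    subst hq
    exact ⟨⟨M, h3⟩, by simp [hS']⟩

end HCN

namespace HCN

lemma exists_smul_iff (n : ℤ) (x y z : ℤ) :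
    (∃ f : ℤ × ℤ × ℤ, (x, y, z) = n • f) ↔ n ∣ x ∧ n ∣ y ∧ n ∣ z := by
  constructor
  · rintro ⟨⟨a, b, c⟩, h⟩
    simp only [Prod.smul_mk, Prod.mk.injEq, smul_eq_mul] at h
    exact ⟨⟨a, h.1⟩, ⟨b, h.2.1⟩, ⟨c, h.2.2⟩⟩
  · rintro ⟨⟨a, ha⟩, ⟨b, hb⟩, ⟨c, hc⟩⟩
    exact ⟨(a, b, c), by simp [ha, hb, hc]⟩

lemma sq_dvd_mul_iff {p : ℕ} (hp : p.Prime) (x : ℤ) : (p : ℤ) ^ 2 ∣ p * x ↔ (p : ℤ) ∣ x := by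
  rw [sq]
  exact mul_dvd_mul_iff_left (by exact_mod_cast hp.ne_zero)

lemma super_none {p : ℕ} (hp : p.Prime) (a b c : ℤ) :
    (∃ f : ℤ × ℤ × ℤ, app (a, b, c) (T p none) = ((p : ℤ) ^ 2) • f) ↔
      (p : ℤ) ^ 2 ∣ a ∧ (p : ℤ) ∣ b := by
  rw [app_T_none, exists_smul_iff, sq_dvd_mul_iff hp]
  simp

lemma super_some {p : ℕ} (hp : p.Prime) (a b c : ℤ) (j : ZMod p) :
    (∃ f : ℤ × ℤ × ℤ, app (a, b, c) (T p (some j)) = ((p : ℤ) ^ 2) • f) ↔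
      (p : ℤ) ^ 2 ∣ a * (j.val : ℤ) ^ 2 + b * j.val + c ∧ (p : ℤ) ∣ 2 * a * j.val + b := by
  rw [app_T_some, exists_smul_iff, dvd_neg, sq_dvd_mul_iff hp]
  simp

lemma mod4_sq (D : ℤ) (b x : ℤ) (hm : D % 4 = 0 ∨ D % 4 = 1) (h : b ^ 2 - D = 2 * x) : (4 : ℤ) ∣ b ^ 2 - D := by
  rcases Int.even_or_odd' b with ⟨k, hk | hk⟩ <;> rw [hk] at h ⊢ <;> ring_nf at h ⊢ <;> omega

/-- the case `p ∣ a` -/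
lemma dr_none {p : ℕ} (hp : p.Prime) {D a b c : ℤ} (hm : D % 4 = 0 ∨ D % 4 = 1)
    (h : b ^ 2 - 4 * a * c = D * p ^ 2) (hpr : Prim (a, b, c)) (ha : (p : ℤ) ∣ a) :
    (p : ℤ) ^ 2 ∣ a ∧ (p : ℤ) ∣ b ∧ ¬ (p : ℤ) ∣ c := by
  have hpi : Prime (p : ℤ) := Nat.prime_iff_prime_int.1 hp
  have hb : (p : ℤ) ∣ b := by
    apply hpi.dvd_of_dvd_pow (n := 2)
    rw [show b ^ 2 = a * (4 * c) + p * (D * p) by linear_combination h]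
    exact dvd_add (ha.mul_right _) (Dvd.intro _ rfl)
  have hc : ¬ (p : ℤ) ∣ c := hpr p hp ha hb
  refine ⟨?_, hb, hc⟩
  have hcop : IsCoprime ((p : ℤ) ^ 2) c := ((hpi.coprime_iff_not_dvd).2 hc).pow_left
  apply hcop.dvd_of_dvd_mul_right
  by_cases h2 : p = 2
  · subst h2
    obtain ⟨b', rfl⟩ := hb
    obtain ⟨a', rfl⟩ := ha
    push_cast at *
    have h3 : b' ^ 2 - D = 2 * a' * c := by linarith
    have := mod4_sq D b' (a' * c) hm (by linarith)
    rw [h3] at this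
    exact this
  · have hcop4 : IsCoprime ((p : ℤ) ^ 2) 4 := by
      have : Nat.Coprime (p ^ 2) (2 ^ 2) :=
        Nat.Coprime.pow _ _ ((Nat.coprime_primes hp Nat.prime_two).2 h2)
      have := Nat.isCoprime_iff_coprime.2 this
      norm_num at this
      exact this
    apply hcop4.dvd_of_dvd_mul_left
    obtain ⟨b', rfl⟩ := hb
    exact ⟨b' ^ 2 - D, by linear_combination -h⟩

lemma dr_some {p : ℕ} (hp : p.Prime) {D a b c : ℤ} (hm : D % 4 = 0 ∨ D % 4 = 1)
    (h : b ^ 2 - 4 * a * c = D * p ^ 2) (ha : ¬ (p : ℤ) ∣ a) :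
    ∃ j : ℤ, (p : ℤ) ^ 2 ∣ a * j ^ 2 + b * j + c ∧ (p : ℤ) ∣ 2 * a * j + b := by
  have hpi : Prime (p : ℤ) := Nat.prime_iff_prime_int.1 hp
  have hcopa : IsCoprime ((p : ℤ) ^ 2) a := ((hpi.coprime_iff_not_dvd).2 ha).pow_left
  by_cases h2 : p = 2
  · subst h2
    push_cast at *
    have hb : (2 : ℤ) ∣ b := by
      apply Int.prime_two.dvd_of_dvd_pow (n := 2)
      exact ⟨2 * a * c + 2 * D, by linear_combination h⟩
    obtain ⟨b', rfl⟩ := hb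
    have h3 : b' ^ 2 - a * c = D := by linarith
    refine ⟨D - b', ?_, ⟨a * (D - b') + b', by ring⟩⟩
    apply hcopa.dvd_of_dvd_mul_left
    have h4 : a * (a * (D - b') ^ 2 + 2 * b' * (D - b') + c) = (a * (D - b') + b') ^ 2 - D := by
      linear_combination -h3
    rw [h4]
    obtain ⟨k, hk⟩ : ∃ k, a = 2 * k + 1 := by
      rcases Int.even_or_odd' a with ⟨k, hk | hk⟩
      · exact (ha ⟨k, hk⟩).elim
      · exact ⟨k, hk⟩
    have hD2 : ∃ m, D ^ 2 - D = 2 * m := by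
      obtain ⟨m, hm⟩ := Int.even_mul_pred_self D
      exact ⟨m, by linear_combination hm⟩
    obtain ⟨m, hm'⟩ := hD2
    have := mod4_sq D (a * (D - b') + b') (2 * (k * (D - b')) ^ 2 + 2 * k * (D - b') * D + m) hm (by
      rw [hk]; linear_combination hm')
    exact this
  · have hcop2 : IsCoprime (p : ℤ) (2 * a) := by
      refine IsCoprime.mul_right ?_ ((hpi.coprime_iff_not_dvd).2 ha)
      exact_mod_cast Nat.isCoprime_iff_coprime.2 ((Nat.coprime_primes hp Nat.prime_two).2 h2)
    obtain ⟨u, v, huv⟩ := hcop2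
    have h5 : (p : ℤ) ∣ 2 * a * (-b * v) + b := ⟨b * u, by linear_combination -b * huv⟩
    refine ⟨-b * v, ?_, h5⟩
    have hcop4 : IsCoprime ((p : ℤ) ^ 2) 4 := by
      have : Nat.Coprime (p ^ 2) (2 ^ 2) :=
        Nat.Coprime.pow _ _ ((Nat.coprime_primes hp Nat.prime_two).2 h2)
      have := Nat.isCoprime_iff_coprime.2 this
      norm_num at this
      exact this
    apply (hcop4.mul_right hcopa).dvd_of_dvd_mul_left
    obtain ⟨w, hw⟩ := h5
    refine ⟨w ^ 2 - D, ?_⟩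
    linear_combination (2 * a * (-b * v) + b + p * w) * hw - h

lemma super_unique {p : ℕ} (hp : p.Prime) {D : ℤ} (hm : D % 4 = 0 ∨ D % 4 = 1) (g : X (D * p ^ 2)) :
    ∃! j, ∃ f : ℤ × ℤ × ℤ, app g.1 (T p j) = ((p : ℤ) ^ 2) • f := by
  obtain ⟨⟨a, b, c⟩, hg⟩ := g
  rw [isPrim_iff] at hg
  obtain ⟨hd, hpr, -⟩ := hg
  simp only [disc] at hd
  have := Fact.mk hp
  have hpi : Prime (p : ℤ) := Nat.prime_iff_prime_int.1 hp
  by_cases ha : (p : ℤ) ∣ a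
  · obtain ⟨h1, h2, h3⟩ := dr_none hp hm hd hpr ha
    refine ⟨none, (super_none hp a b c).2 ⟨h1, h2⟩, ?_⟩
    intro j hj
    cases j with
    | none => rfl
    | some j =>
      exfalso
      obtain ⟨h4, -⟩ := (super_some hp a b c j).1 hj
      apply h3
      have h5 := (Dvd.intro_left _ (sq (p : ℤ)).symm).trans h4
      have h6 : (p : ℤ) ∣ a * (j.val : ℤ) ^ 2 + b * j.val :=
        dvd_add (ha.mul_right _) (h2.mul_right _)
      exact (dvd_add_right h6).1 h5
  · obtain ⟨j, h1, h2⟩ := dr_some hp hm hd ha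
    refine ⟨some (j : ZMod p), ?_, ?_⟩
    · apply (super_some hp a b c (j : ZMod p)).2
      obtain ⟨t, ht⟩ : (p : ℤ) ∣ ((j : ZMod p).val : ℤ) - j := by
        rw [← ZMod.intCast_zmod_eq_zero_iff_dvd]
        simp
      have hv : ((j : ZMod p).val : ℤ) = j + p * t := by linarith
      rw [hv]
      obtain ⟨x, hx⟩ := h1
      obtain ⟨y, hy⟩ := h2
      refine ⟨⟨x + t * y + a * t ^ 2, ?_⟩, ⟨y + 2 * a * t, ?_⟩⟩
      · linear_combination hx + p * t * hy
      · linear_combination hy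
    · intro k hk
      cases k with
      | none =>
        obtain ⟨h4, -⟩ := (super_none hp a b c).1 hk
        exact (ha ((Dvd.intro_left _ (sq (p : ℤ)).symm).trans h4)).elim
      | some k =>
        obtain ⟨h4, h5⟩ := (super_some hp a b c k).1 hk
        have hdv : (p : ℤ) ∣ (k.val : ℤ) - j := by
          by_contra hn
          have h6 : (p : ℤ) ^ 2 ∣ ((k.val : ℤ) - j) * (2 * a * k.val + b - a * (k.val - j)) := by
            have := dvd_sub h4 h1
            rwa [show ((k.val : ℤ) - j) * (2 * a * k.val + b - a * (k.val - j)) =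
              a * (k.val : ℤ) ^ 2 + b * k.val + c - (a * j ^ 2 + b * j + c) by ring]
          have hcop : IsCoprime ((p : ℤ) ^ 2) ((k.val : ℤ) - j) :=
            ((hpi.coprime_iff_not_dvd).2 hn).pow_left
          have h7 := (Dvd.intro_left _ (sq (p : ℤ)).symm).trans (hcop.dvd_of_dvd_mul_left h6)
          have h8 := (dvd_sub_right h5).1 h7
          rcases hpi.dvd_or_dvd h8 with h | h
          · exact ha h
          · exact hn h
        rw [← ZMod.intCast_zmod_eq_zero_iff_dvd] at hdv
        push_cast at hdv
        rw [ZMod.natCast_zmod_val, sub_eq_zero] at hdv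
        rw [hdv]

/-! ### counting zeros -/

def Pv {R : Type*} [CommRing R] (a b c : R) : Option R → R
  | none => a
  | some j => a * j ^ 2 + b * j + c

lemma cast_app_T {p : ℕ} [NeZero p] (a b c : ℤ) (j : Option (ZMod p)) :
    (((app (a, b, c) (T p j)).1 : ℤ) : ZMod p) = Pv (a : ZMod p) b c j := by
  cases j with
  | none => rw [app_T_none]; rfl
  | some j => rw [app_T_some]; simp [Pv]

lemma card_zeros {F : Type*} [Field F] [Fintype F] [DecidableEq F] (hF : ringChar F ≠ 2) (a b c : F)
    (h : ¬ (a = 0 ∧ b = 0 ∧ c = 0)) :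
    (Nat.card {j : Option F // ¬ Pv a b c j = 0} : ℤ) =
      Fintype.card F - quadraticChar F (b ^ 2 - 4 * a * c) := by
  have h2 : (2 : F) ≠ 0 := Ring.two_ne_zero hF
  have hz : (Nat.card {j : Option F // Pv a b c j = 0} : ℤ) =
      1 + quadraticChar F (b ^ 2 - 4 * a * c) := by
    by_cases ha : a = 0
    · subst ha
      simp only [zero_mul, mul_zero, sub_zero]
      by_cases hb : b = 0
      · subst hb
        have hc : c ≠ 0 := by tauto
        have : {j : Option F // Pv 0 0 c j = 0} ≃ {j : Option F // j = none} := by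
          refine Equiv.subtypeEquivRight fun j => ?_
          cases j <;> simp [Pv, hc]
        rw [Nat.card_congr this]
        simp
      · rw [quadraticChar_sq_one' hb]
        have : {j : Option F // Pv 0 b c j = 0} ≃
            {j : Option F // j ∈ ({none, some (-c / b)} : Finset (Option F))} := by
          refine Equiv.subtypeEquivRight fun j => ?_
          cases j with
          | none => simp [Pv]
          | some j =>
            simp only [Pv, Finset.mem_insert, Finset.mem_singleton, Option.some.injEq, reduceCtorEq,
              false_or, eq_div_iff hb]
            constructor
            · intro h; linear_combination h
            · intro h; linear_combination h
        rw [Nat.card_congr this, Nat.card_eq_fintype_card, Fintype.card_coe,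
          Finset.card_pair (by simp)]
        norm_num
    · rw [add_comm, ← quadraticChar_card_sqrts hF, Set.toFinset_card, ← Nat.card_eq_fintype_card]
      congr 1
      symm
      have hs : ∀ s : F, Pv a b c (some ((s - b) / (2 * a))) = 0 ↔ s ^ 2 = b ^ 2 - 4 * a * c := by
        intro s
        have : Pv a b c (some ((s - b) / (2 * a))) = (s ^ 2 - (b ^ 2 - 4 * a * c)) / (4 * a) := by
          simp only [Pv]
          have h4 : (4 : F) = 2 * 2 := by norm_num
          rw [h4]
          field_simp
          ring
        rw [this, div_eq_zero_iff, sub_eq_zero]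
        have h4 : (4 : F) * a ≠ 0 := mul_ne_zero (by
          rw [show (4 : F) = 2 * 2 by norm_num]; exact mul_ne_zero h2 h2) ha
        simp [h4]
      refine Nat.card_congr (Equiv.ofBijective
        (fun s => ⟨some ((s.1 - b) / (2 * a)), (hs s.1).2 s.2⟩) ⟨?_, ?_⟩)
      · intro s t hst
        simp only [Subtype.mk.injEq, Option.some.injEq] at hst
        have : (2 * a) ≠ 0 := mul_ne_zero h2 ha
        rw [div_left_inj' this] at hst
        exact Subtype.ext (by linear_combination hst)
      · rintro ⟨j, hj⟩
        cases j with
        | none => exact (ha hj).elim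
        | some j =>
          have hj' : j = ((2 * a * j + b) - b) / (2 * a) := by field_simp; ring
          have hj2 := hj
          rw [hj', hs] at hj2
          exact ⟨⟨2 * a * j + b, hj2⟩, Subtype.ext (congrArg some hj'.symm)⟩
  have ht := Fintype.card_subtype_compl (fun j : Option F => Pv a b c j = 0)
  have hle := Fintype.card_subtype_le (fun j : Option F => Pv a b c j = 0)
  rw [Nat.card_eq_fintype_card] at hz ⊢
  rw [ht, Nat.cast_sub hle, hz, Fintype.card_option]
  push_cast; ring

lemma card_zeros_two : ∀ a b c : ZMod 2, ¬ (a = 0 ∧ b = 0 ∧ c = 0) →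
    Fintype.card {j : Option (ZMod 2) // ¬ Pv a b c j = 0} =
      if b = 0 then 2 else if a * c = 0 then 1 else 3 := by
  have key : ∀ a b c : ZMod 2, ¬ (a = 0 ∧ b = 0 ∧ c = 0) →
    (if a = 0 then 0 else 1) + ((if c = 0 then 0 else 1) + (if a + b + c = 0 then 0 else 1)) =
      if b = 0 then 2 else if a * c = 0 then 1 else 3 := by decide
  intro a b c h
  rw [← key a b c h, Fintype.card_subtype, Finset.card_filter, Fintype.sum_option]
  have : ∀ g : ZMod 2 → ℕ, ∑ i, g i = g 0 + g 1 := fun g => Fin.sum_univ_two g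
  rw [this]
  congr 1
  · by_cases ha : a = 0 <;> simp [Pv, ha]
  · congr 1
    · by_cases ha : c = 0 <;> simp [Pv, ha]
    · by_cases ha : a + b + c = 0 <;> simp [Pv, ha]

lemma card_K {p : ℕ} (hp : p.Prime) {D : ℤ} (f : X D) :
    (Nat.card {j : Option (ZMod p) // ¬ (p : ℤ) ∣ (app f.1 (T p j)).1} : ℤ) = p - kroneckerSym D p := by
  have := Fact.mk hp
  obtain ⟨⟨a, b, c⟩, hf⟩ := f
  rw [isPrim_iff] at hf
  obtain ⟨hd, hpr, -⟩ := hf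
  simp only [disc] at hd
  have hne : ¬ ((a : ZMod p) = 0 ∧ (b : ZMod p) = 0 ∧ (c : ZMod p) = 0) := by
    simp only [ZMod.intCast_zmod_eq_zero_iff_dvd]
    rintro ⟨h1, h2, h3⟩
    exact hpr p hp h1 h2 h3
  simp_rw [← ZMod.intCast_zmod_eq_zero_iff_dvd, cast_app_T]
  by_cases h2 : p = 2
  · subst h2
    rw [Nat.card_eq_fintype_card, card_zeros_two _ _ _ hne]
    have hk : kroneckerSym D 2 = kron2 D := by
      simp [kroneckerSym]
    rw [hk, kron2]
    rw [← Int.cast_mul]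
    simp only [ZMod.intCast_zmod_eq_zero_iff_dvd]
    have hd' : D = b ^ 2 - 4 * (a * c) := by rw [← hd]; ring
    generalize a * c = m at *
    rcases Int.even_or_odd' b with ⟨k, hk | hk⟩
    · have h1 : D % 2 = 0 := by rw [hd', hk]; ring_nf; omega
      have h2 : ((2 : ℕ) : ℤ) ∣ b := ⟨k, hk⟩
      rw [if_pos h1, if_pos h2]; norm_num
    · obtain ⟨s, hs⟩ := Int.even_mul_succ_self k
      have h3 : D = 8 * s + 1 - 4 * m := by rw [hd', hk]; linear_combination 4 * hs
      have h1 : ¬ D % 2 = 0 := by omega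
      have h2 : ¬ ((2 : ℕ) : ℤ) ∣ b := by push_cast; omega
      rw [if_neg h1, if_neg h2]
      by_cases hm : ((2 : ℕ) : ℤ) ∣ m
      · rw [if_pos hm, if_pos (by push_cast at hm; omega)]; norm_num
      · rw [if_neg hm, if_neg (by push_cast at hm; omega)]; norm_num
  · rw [card_zeros (by rwa [ZMod.ringChar_zmod_n]) _ _ _ hne, ZMod.card]
    congr 1
    have hv : padicValNat 2 p = 0 := by
      apply padicValNat.eq_zero_of_not_dvd
      rw [Nat.prime_dvd_prime_iff_eq Nat.prime_two hp]
      exact fun h => h2 h.symm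
    rw [kroneckerSym, hv, pow_zero, pow_zero, one_mul, Nat.div_one, ← jacobiSym.legendreSym.to_jacobiSym,
      legendreSym, ← hd]
    push_cast
    congr!

lemma kron_le (D : ℤ) {p : ℕ} (hp : p.Prime) : kroneckerSym D p ≤ 1 := by
  have h2 : kron2 D ≤ 1 := by
    unfold kron2; split_ifs <;> norm_num
  by_cases h : p = 2
  · subst h
    simpa [kroneckerSym] using h2
  · have hv : padicValNat 2 p = 0 := by
      apply padicValNat.eq_zero_of_not_dvd
      rw [Nat.prime_dvd_prime_iff_eq Nat.prime_two hp]
      exact fun h' => h h'.symm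
    rw [kroneckerSym, hv, pow_zero, pow_zero, one_mul, Nat.div_one]
    rcases jacobiSym.trichotomy D p with h | h | h <;> rw [h] <;> norm_num

/-- The basic recursion. -/
lemma step {p : ℕ} (hp : p.Prime) {D : ℤ} (hD : D < 0) (hm : D % 4 = 0 ∨ D % 4 = 1) :
    (classNum (D * p ^ 2) : ℚ) / ((wAut (D * p ^ 2) : ℚ) / 2) =
      (classNum D : ℚ) / ((wAut D : ℚ) / 2) * (p - kroneckerSym D p) := by
  have hk1 := kron_le D hp
  have hp1 : (1 : ℤ) < p := by exact_mod_cast hp.one_lt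
  obtain ⟨k, hk⟩ : ∃ k : ℕ, (k : ℤ) = p - kroneckerSym D p :=
    ⟨(p - kroneckerSym D p).toNat, Int.toNat_of_nonneg (by omega)⟩
  have hk0 : k ≠ 0 := by omega
  have hK : ∀ f : X D, Nat.card {j : Option (ZMod p) // ¬ (p : ℤ) ∣ (app f.1 (T p j)).1} = k := by
    intro f
    have := card_K hp f
    rw [← hk] at this
    exact_mod_cast this
  have e1 := card_sigma_const (mul_ne_zero hk0 (wAut_ne (D * p ^ 2)))
    (fun q : Cl D => (side1 hp hD q.out).trans (by rw [hK]))
  have e2 := card_sigma_const (wAut_ne D)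
    (fun q : Cl (D * p ^ 2) => side2 hp hD q.out (super_unique hp hm q.out))
  have e : (Σ q : Cl D, {x : Cl (D * p ^ 2) × M2 // x.2.det = p ∧ app q.out.1 x.2 = x.1.out.1}) ≃
      (Σ q : Cl (D * p ^ 2), {x : Cl D × M2 // x.2.det = p ∧ app x.1.out.1 x.2 = q.out.1}) :=
    { toFun := fun x => ⟨x.2.1.1, ⟨(x.1, x.2.1.2), x.2.2⟩⟩
      invFun := fun x => ⟨x.2.1.1, ⟨(x.1, x.2.1.2), x.2.2⟩⟩
      left_inv := fun _ => rfl
      right_inv := fun _ => rfl }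
  rw [Nat.card_congr e, e2, ← classNum_eq, ← classNum_eq] at e1
  have e1' : (classNum (D * p ^ 2) : ℚ) * wAut D = classNum D * (k * wAut (D * p ^ 2)) := by
    exact_mod_cast e1
  have hkq : (p : ℚ) - kroneckerSym D p = k := by
    have : ((k : ℤ) : ℚ) = ((p - kroneckerSym D p : ℤ) : ℚ) := by rw [hk]
    push_cast at this
    exact this.symm
  have w1 : (wAut D : ℚ) ≠ 0 := by exact_mod_cast wAut_ne D
  have w2 : (wAut (D * p ^ 2) : ℚ) ≠ 0 := by exact_mod_cast wAut_ne _
  rw [hkq]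
  field_simp
  linear_combination e1'

end HCN

namespace HCN

lemma kron_mul_sq (d : ℤ) (a : ℕ) {p : ℕ} (hp : p.Prime) :
    kroneckerSym (d * (a : ℤ) ^ 2) p = if p ∣ a then 0 else kroneckerSym d p := by
  by_cases h : p = 2
  · subst h
    have hk : ∀ D : ℤ, kroneckerSym D 2 = kron2 D := by
      intro D
      simp [kroneckerSym]
    rw [hk, hk]
    split_ifs with h2
    · obtain ⟨b, rfl⟩ := h2
      unfold kron2
      rw [if_pos]
      push_cast
      rw [show d * (2 * (b : ℤ)) ^ 2 = 2 * (2 * d * b ^ 2) by ring]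
      omega
    · obtain ⟨k, hk⟩ : ∃ k, a = 2 * k + 1 := ⟨a / 2, by omega⟩
      obtain ⟨s, hs⟩ := Int.even_mul_succ_self (k : ℤ)
      have : d * (a : ℤ) ^ 2 = d + 8 * (s * d) := by
        rw [hk]; push_cast; linear_combination 4 * d * hs
      unfold kron2
      rw [this]
      have h8 : (d + 8 * (s * d)) % 8 = d % 8 := by omega
      have h2 : (d + 8 * (s * d)) % 2 = d % 2 := by omega
      rw [h8, h2]
  · have hv : padicValNat 2 p = 0 := by
      apply padicValNat.eq_zero_of_not_dvd
      rw [Nat.prime_dvd_prime_iff_eq Nat.prime_two hp]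
      exact fun h' => h h'.symm
    have := Fact.mk hp
    simp only [kroneckerSym, hv, pow_zero, one_mul, Nat.div_one]
    rw [jacobiSym.mul_left]
    split_ifs with h2
    · have : jacobiSym (a : ℤ) p = 0 := by
        rw [← jacobiSym.legendreSym.to_jacobiSym, legendreSym.eq_zero_iff]
        rw [ZMod.intCast_zmod_eq_zero_iff_dvd]
        exact_mod_cast h2
      rw [jacobiSym.pow_left, this]; simp
    · rw [jacobiSym.sq_one', mul_one]
      rw [Int.gcd_natCast_natCast]
      exact ((Nat.Prime.coprime_iff_not_dvd hp).2 h2).symm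

/-- weighted class number -/
noncomputable def hw (D : ℤ) : ℚ := (classNum D : ℚ) / ((wAut D : ℚ) / 2)

noncomputable def lf (d : ℤ) (p k : ℕ) : ℚ :=
  if k = 0 then 1 else (p : ℚ) ^ (k - 1) * (p - kroneckerSym d p)

noncomputable def psi (d : ℤ) : ArithmeticFunction ℚ :=
  ⟨fun n => if n = 0 then 0 else n.factorization.prod (lf d), by simp⟩

lemma psi_apply (d : ℤ) {n : ℕ} (hn : n ≠ 0) : psi d n = n.factorization.prod (lf d) := by
  show (if n = 0 then 0 else n.factorization.prod (lf d)) = _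
  rw [if_neg hn]

lemma psi_mult (d : ℤ) : (psi d).IsMultiplicative := by
  rw [ArithmeticFunction.IsMultiplicative.iff_ne_zero]
  refine ⟨by rw [psi_apply d one_ne_zero]; simp, ?_⟩
  intro m n hm hn hc
  rw [psi_apply d hm, psi_apply d hn, psi_apply d (mul_ne_zero hm hn), Nat.factorization_mul hm hn]
  apply Finsupp.prod_add_index_of_disjoint
  simpa using hc.disjoint_primeFactors

lemma psi_prime_pow (d : ℤ) {p : ℕ} (hp : p.Prime) (k : ℕ) : psi d (p ^ k) = lf d p k := by
  rw [psi_apply d (pow_ne_zero _ hp.ne_zero), hp.factorization_pow, Finsupp.prod_single_index]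
  simp [lf]

lemma mod4 {d : ℤ} (hm : d % 4 = 0 ∨ d % 4 = 1) (a : ℤ) : (d * a ^ 2) % 4 = 0 ∨ (d * a ^ 2) % 4 = 1 := by
  rcases Int.even_or_odd' a with ⟨k, hk | hk⟩
  · left
    rw [hk, show d * (2 * k) ^ 2 = 4 * (d * k ^ 2) by ring]; omega
  · rw [hk, show d * (2 * k + 1) ^ 2 = 4 * (d * k ^ 2 + d * k) + d by ring]; omega

lemma hw_pow {d : ℤ} (hd : d < 0) (hm : d % 4 = 0 ∨ d % 4 = 1) {p a : ℕ} (hp : p.Prime)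
    (ha : ¬ p ∣ a) (n : ℕ) :
    hw (d * ((p ^ n * a : ℕ) : ℤ) ^ 2) = hw (d * (a : ℤ) ^ 2) * lf d p n := by
  have ha0 : a ≠ 0 := by rintro rfl; simp at ha
  induction n with
  | zero => simp [lf]
  | succ n ih =>
    have hD : d * ((p ^ n * a : ℕ) : ℤ) ^ 2 < 0 :=
      mul_neg_of_neg_of_pos hd (pow_pos (by
        exact_mod_cast Nat.pos_of_ne_zero (mul_ne_zero (pow_ne_zero _ hp.ne_zero) ha0)) 2)
    have := step hp hD (mod4 hm _)
    rw [kron_mul_sq d _ hp] at this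
    change hw _ = hw _ * _ at this
    rw [show d * ((p ^ (n + 1) * a : ℕ) : ℤ) ^ 2 = d * ((p ^ n * a : ℕ) : ℤ) ^ 2 * (p : ℤ) ^ 2 by
      push_cast; ring, this, ih]
    cases n with
    | zero => simp [lf, ha]
    | succ n =>
      have : p ∣ p ^ (n + 1) * a := Dvd.dvd.mul_right (dvd_pow_self _ (Nat.succ_ne_zero n)) _
      simp only [lf, this, if_true]
      simp
      ring

lemma hw_eq {d : ℤ} (hd : d < 0) (hm : d % 4 = 0 ∨ d % 4 = 1) (F : ℕ) (hF : F ≠ 0) :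
    hw (d * (F : ℤ) ^ 2) = hw d * psi d F := by
  induction F using Nat.recOnPrimePow with
  | zero => exact (hF rfl).elim
  | one => simp [(psi_mult d).1]
  | prime_pow_mul a p n hp hpa hn ih =>
    have ha0 : a ≠ 0 := by rintro rfl; simp at hpa
    rw [hw_pow hd hm hp hpa, ih ha0, (psi_mult d).2 (((Nat.Prime.coprime_iff_not_dvd hp).2 hpa).pow_left n),
      psi_prime_pow d hp]
    ring

lemma hw_zero {D : ℤ} (hm : ¬ (D % 4 = 0 ∨ D % 4 = 1)) : hw D = 0 := by
  have : IsEmpty (X D) := by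
    constructor
    rintro ⟨⟨a, b, c⟩, h, -⟩
    apply hm
    simp only at h
    rw [show b ^ 2 - 4 * a * c = b ^ 2 - 4 * (a * c) by ring] at h
    rcases Int.even_or_odd' b with ⟨k, hk | hk⟩ <;> rw [hk] at h <;> ring_nf at h <;> omega
  have : IsEmpty (Cl D) := ⟨fun q => this.elim q.out⟩
  unfold hw
  rw [classNum_eq]
  simp

lemma fund_mod {d : ℤ} (h : IsFundamentalDisc d) : d % 4 = 0 ∨ d % 4 = 1 := by
  rcases h with h | h
  · exact Or.inr h.1
  · exact Or.inl h.1

lemma fund_dvd {d : ℤ} (h : IsFundamentalDisc d) {D : ℤ} {f F : ℕ} (hf : f ≠ 0) (hD : D % 4 = 0 ∨ D % 4 = 1)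
    (e : d * (F : ℤ) ^ 2 = D * (f : ℤ) ^ 2) : f ∣ F := by
  obtain ⟨g, f', F', hg, hcop, rfl, rfl⟩ := Nat.exists_coprime' (m := f) (n := F)
    (Nat.gcd_pos_of_pos_left _ (Nat.pos_of_ne_zero hf))
  have e' : d * (F' : ℤ) ^ 2 = D * (f' : ℤ) ^ 2 := by
    have hg2 : (g : ℤ) ^ 2 ≠ 0 := pow_ne_zero _ (by exact_mod_cast hg.ne')
    apply mul_right_cancel₀ hg2
    push_cast at e
    linear_combination e
  suffices hf1 : f' = 1 by rw [hf1, one_mul]; exact Dvd.intro_left _ rfl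
  by_contra hne
  obtain ⟨q, hq, hqf⟩ := Nat.exists_prime_and_dvd hne
  have hqi : Prime (q : ℤ) := Nat.prime_iff_prime_int.1 hq
  have hqF : ¬ q ∣ F' := fun h' => hq.one_lt.ne' (Nat.dvd_one.1 (hcop ▸ Nat.dvd_gcd hqf h'))
  have hqd : (q : ℤ) ^ 2 ∣ d := by
    have hc : IsCoprime ((q : ℤ) ^ 2) ((F' : ℤ) ^ 2) :=
      (Nat.isCoprime_iff_coprime.2 ((Nat.Prime.coprime_iff_not_dvd hq).2 hqF)).pow
    apply hc.dvd_of_dvd_mul_right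
    rw [e']
    exact (pow_dvd_pow_of_dvd (by exact_mod_cast hqf) 2).mul_left _
  rcases h with ⟨-, hs⟩ | ⟨h4, hs, h23⟩
  · exact hqi.not_isUnit (hs q (by rw [← sq]; exact hqd))
  · obtain ⟨m, hm⟩ : ∃ m, d = 4 * m := ⟨d / 4, by omega⟩
    have hdm : d / 4 = m := by omega
    rw [hdm] at hs h23
    by_cases hq2 : q = 2
    · subst hq2
      obtain ⟨k, rfl⟩ := hqf
      rw [hm] at e'
      push_cast at e'
      have e2 : m * (F' : ℤ) ^ 2 = D * (k : ℤ) ^ 2 := by linarith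
      have h5 := mod4 hD (k : ℤ)
      rw [← e2] at h5
      obtain ⟨l, hl⟩ : ∃ l : ℕ, F' = 2 * l + 1 := ⟨F' / 2, by omega⟩
      rw [hl] at h5
      push_cast at h5
      rw [show m * (2 * (l : ℤ) + 1) ^ 2 = 4 * (m * l ^ 2 + m * l) + m by ring] at h5
      omega
    · have hc : IsCoprime ((q : ℤ) ^ 2) 4 := by
        have : Nat.Coprime (q ^ 2) (2 ^ 2) :=
          Nat.Coprime.pow _ _ ((Nat.coprime_primes hq Nat.prime_two).2 hq2)
        have := Nat.isCoprime_iff_coprime.2 this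
        norm_num at this
        exact this
      rw [hm] at hqd
      exact hqi.not_isUnit (hs q (by rw [← sq]; exact hc.dvd_of_dvd_mul_left hqd))

lemma sum_lf (d : ℤ) {p : ℕ} (hp : p.Prime) (k : ℕ) :
    ∑ i ∈ Finset.range (k + 1), lf d p i = ((p : ℚ) ^ (k + 1) - 1 -
              (kroneckerSym d p : ℚ) * ((p : ℚ) ^ k - 1)) / ((p : ℚ) - 1) := by
  have hp1 : (p : ℚ) - 1 ≠ 0 := by
    have : (1 : ℚ) < p := by exact_mod_cast hp.one_lt
    linarith
  rw [eq_div_iff hp1]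
  induction k with
  | zero => simp [lf]
  | succ k ih =>
    rw [Finset.sum_range_succ, add_mul, ih]
    simp only [lf, Nat.succ_ne_zero, if_false, Nat.add_sub_cancel]
    ring

theorem main (N : ℕ) (hN : 0 < N) (hmod : N % 4 = 0 ∨ N % 4 = 3)
    (d : ℤ) (F : ℕ) (hfund : IsFundamentalDisc d) (hdF : -(N : ℤ) = d * (F : ℤ) ^ 2) :
    hurwitz (N : ℚ) =
      (classNum d : ℚ) / ((wAut d : ℚ) / 2) *
        ∏ᶠ p ∈ {p : ℕ | p.Prime},
          (((p : ℚ) ^ (F.factorization p + 1) - 1 -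
              (kroneckerSym d p : ℚ) * ((p : ℚ) ^ (F.factorization p) - 1)) / ((p : ℚ) - 1)) := by
  have hF : F ≠ 0 := by
    rintro rfl
    simp at hdF; omega
  have hd : d < 0 := by
    by_contra h
    have : 0 ≤ d * (F : ℤ) ^ 2 := mul_nonneg (by omega) (sq_nonneg _)
    omega
  have hm := fund_mod hfund
  have hH : hurwitz (N : ℚ) = ∑ f ∈ N.divisors.filter (fun f => f ^ 2 ∣ N), hw (-((N / f ^ 2 : ℕ) : ℤ)) := by
    unfold hurwitz
    rw [if_pos ⟨by simp, by simp⟩]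
    rw [Rat.num_natCast, Int.toNat_natCast]
    unfold hurwitzNat
    rw [if_pos ⟨hN, hmod⟩]
    rfl
  have hNF : N = d.natAbs * F ^ 2 := by
    have := congrArg Int.natAbs hdF
    simpa [Int.natAbs_mul, Int.natAbs_pow] using this
  have hsub : F.divisors ⊆ N.divisors.filter (fun f => f ^ 2 ∣ N) := by
    intro f hf
    have hfF := (Nat.mem_divisors.1 hf).1
    have h2 : f ^ 2 ∣ N := by rw [hNF]; exact (pow_dvd_pow_of_dvd hfF 2).mul_left _
    rw [Finset.mem_filter, Nat.mem_divisors]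
    exact ⟨⟨(dvd_pow_self f two_ne_zero).trans h2, hN.ne'⟩, h2⟩
  have hS : hurwitz (N : ℚ) = ∑ f ∈ F.divisors, hw (d * ((F / f : ℕ) : ℤ) ^ 2) := by
    rw [hH, ← Finset.sum_subset hsub]
    · refine Finset.sum_congr rfl fun f hf => ?_
      obtain ⟨g, rfl⟩ := (Nat.mem_divisors.1 hf).1
      have hf0 : 0 < f := Nat.pos_of_mem_divisors hf
      rw [Nat.mul_div_cancel_left _ hf0]
      congr 1
      have : N / f ^ 2 = d.natAbs * g ^ 2 := by
        rw [hNF]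
        apply Nat.div_eq_of_eq_mul_left (by positivity)
        ring
      rw [this]
      push_cast
      rw [abs_of_neg hd]
      ring
    · intro f hf hnf
      rw [Finset.mem_filter, Nat.mem_divisors] at hf
      apply hw_zero
      intro h4
      apply hnf
      rw [Nat.mem_divisors]
      refine ⟨fund_dvd hfund ?_ h4 ?_, hF⟩
      · rintro rfl
        simp at hf
      · rw [← hdF]
        have := Nat.div_mul_cancel hf.2
        have h5 : ((N / f ^ 2 : ℕ) : ℤ) * (f : ℤ) ^ 2 = N := by exact_mod_cast this
        linarith
  rw [hS, Nat.sum_div_divisors F (fun m => hw (d * (m : ℤ) ^ 2))]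
  have h1 : ∑ m ∈ F.divisors, hw (d * (m : ℤ) ^ 2) = hw d * ∑ m ∈ F.divisors, psi d m := by
    rw [Finset.mul_sum]
    exact Finset.sum_congr rfl fun m hm' => hw_eq hd hm m (Nat.pos_of_mem_divisors hm').ne'
  rw [h1]
  change _ = hw d * _
  congr 1
  rw [← ArithmeticFunction.coe_mul_zeta_apply,
    ((psi_mult d).mul ArithmeticFunction.isMultiplicative_zeta.natCast).multiplicative_factorization _ hF]
  rw [finprod_mem_eq_prod_of_inter_mulSupport_eq (t := F.primeFactors)]
  · unfold Finsupp.prod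
    rw [Nat.support_factorization]
    refine Finset.prod_congr rfl fun p hp => ?_
    have hp := Nat.prime_of_mem_primeFactors hp
    beta_reduce
    rw [ArithmeticFunction.coe_mul_zeta_apply, Nat.sum_divisors_prime_pow hp, ← sum_lf d hp]
    exact Finset.sum_congr rfl fun i _ => psi_prime_pow d hp i
  · ext p
    simp only [Set.mem_inter_iff, Set.mem_ofPred_eq, Function.mem_mulSupport, Finset.mem_coe]
    constructor
    · rintro ⟨hp, h⟩
      refine ⟨?_, h⟩
      by_contra hnp
      apply h
      have h0 : F.factorization p = 0 := by
        rwa [← Finsupp.notMem_support_iff, Nat.support_factorization]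
      rw [h0, ← sum_lf d hp]
      simp [lf]
    · rintro ⟨hp, h⟩
      exact ⟨Nat.prime_of_mem_primeFactors hp, h⟩

end HCN

/-- The Hurwitz class number `H(N)` in terms of the class number of the
fundamental discriminant `d` of `ℚ(√-N)`, where `-N = d F²`. -/
theorem hurwitz_eq_classNum_mul_prod (N : ℕ) (hN : 0 < N) (hmod : N % 4 = 0 ∨ N % 4 = 3)
    (d : ℤ) (F : ℕ) (hfund : IsFundamentalDisc d) (hdF : -(N : ℤ) = d * (F : ℤ) ^ 2) :
    hurwitz (N : ℚ) =
      (classNum d : ℚ) / ((wAut d : ℚ) / 2) *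
        ∏ᶠ p ∈ {p : ℕ | p.Prime},
          (((p : ℚ) ^ (F.factorization p + 1) - 1 -
              (kroneckerSym d p : ℚ) * ((p : ℚ) ^ (F.factorization p) - 1)) / ((p : ℚ) - 1)) := by
  exact HCN.main N hN hmod d F hfund hdF
end
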